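/- In the chapter B case 2 setting, suppose n₁ = n₂. Then S(V)^G is Gorenstein if and only if λ₂(g)^{p^{n₁}} λ₁(g)^{p^{n₁}} λ(g) = 1 for all g ∈ G. -/

import Mathlib

noncomputable section
open CategoryTheory Matrix MvPolynomial

universe u

/-- A module `M` over `R` has finite injective dimension iff the Ext functors
`Ext^i(-, M)` vanish for all sufficiently large `i`. -/
def HasFiniteInjectiveDimension (R : Type u) [CommRing R] (M : ModuleCat.{u} R) : Prop :=
  ∃ n : ℕ, ∀ (N : ModuleCat.{u} R) (i : ℕ), n < i →
    Subsingleton (((Ext R (ModuleCat.{u} R) i).obj (Opposite.op N)).obj M)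

/-- A commutative ring is Gorenstein if it is Noetherian and its localization at every
prime ideal has finite injective dimension over itself. -/
def IsGorensteinRing (R : Type u) [CommRing R] : Prop :=
  IsNoetherianRing R ∧ ∀ (P : Ideal R) [P.IsPrime],
    HasFiniteInjectiveDimension (Localization.AtPrime P)
      (ModuleCat.of (Localization.AtPrime P) (Localization.AtPrime P))

/-- The substitution action of a matrix on polynomials: `X i ↦ ∑ j, M i j • X j`. -/
def polyAct {F : Type u} [CommSemiring F] {m : ℕ} (M : Matrix (Fin m) (Fin m) F) :
    MvPolynomial (Fin m) F →ₐ[F] MvPolynomial (Fin m) F :=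
  MvPolynomial.aeval fun i => ∑ j, M i j • MvPolynomial.X j

/-- The subalgebra of polynomials invariant under a set of matrices. -/
def invariantAlg {F : Type u} [CommSemiring F] {m : ℕ} (S : Set (Matrix (Fin m) (Fin m) F)) :
    Subalgebra F (MvPolynomial (Fin m) F) where
  carrier := {f | ∀ M ∈ S, polyAct M f = f}
  mul_mem' := fun hf hg => fun M hM => by rw [_root_.map_mul, hf M hM, hg M hM]
  add_mem' := fun hf hg => fun M hM => by rw [_root_.map_add, hf M hM, hg M hM]
  algebraMap_mem' := fun r => fun M hM => (polyAct M).commutes r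

/-- The invariant ring `S(V)^G` for a subgroup `G` of `SL(m, F)`, where `S(V)` is realised
as the polynomial ring `F[X 0, …, X (m-1)]`. -/
def invariantRing {F : Type u} [Field F] {m : ℕ}
    (G : Subgroup (Matrix.SpecialLinearGroup (Fin m) F)) :
    Subalgebra F (MvPolynomial (Fin m) F) :=
  invariantAlg {M | ∃ g ∈ G, (g : Matrix (Fin m) (Fin m) F) = M}

/-- A matrix `M` is a transvection if `rank (M - 1) = 1` and `(M - 1)² = 0`. -/
def IsTransvectionMat {F : Type u} [Field F] {m : ℕ} (M : Matrix (Fin m) (Fin m) F) : Prop :=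
  (M - 1).rank = 1 ∧ (M - 1) * (M - 1) = 0

/-- `T(G)`: the subgroup generated by all transvections contained in `G`. -/
def transSubgroup {F : Type u} [Field F] {m : ℕ}
    (G : Subgroup (Matrix.SpecialLinearGroup (Fin m) F)) :
    Subgroup (Matrix.SpecialLinearGroup (Fin m) F) :=
  Subgroup.closure {g | g ∈ G ∧ IsTransvectionMat (g : Matrix (Fin m) (Fin m) F)}

/-- The unipotent upper triangular matrix `!![1,0,x; 0,1,y; 0,0,1]`: with respect to the
basis `{w₂, w₁, v}` it is the transvection `w₂ ↦ w₂ + x·v`, `w₁ ↦ w₁ + y·v`, `v ↦ v`. -/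
def upperMat {F : Type u} [Field F] (x y : F) : Matrix (Fin 3) (Fin 3) F :=
  !![1, 0, x; 0, 1, y; 0, 0, 1]

/-- Vanishing of `Ext` computed by a projective resolution. -/
lemma subsingleton_derived_ext_iff {R : Type u} [CommRing R] {N : ModuleCat.{u} R}
    (P : ProjectiveResolution N) (M : ModuleCat.{u} R) (i : ℕ) :
    Subsingleton (((Ext R (ModuleCat.{u} R) (i + 1)).obj (Opposite.op N)).obj M) ↔
      ∀ f : P.complex.X (i + 1) ⟶ M, P.complex.d (i + 2) (i + 1) ≫ f = 0 →
        ∃ g : P.complex.X i ⟶ M, P.complex.d (i + 1) i ≫ g = f := by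
  have e := P.isoExt (R := R) (i + 1) M
  have h1 : Subsingleton (((Ext R (ModuleCat.{u} R) (i + 1)).obj (Opposite.op N)).obj M) ↔
      Subsingleton ((P.complex.linearYonedaObj R M).homology (i + 1)) :=
    (CategoryTheory.Iso.toLinearEquiv e).toEquiv.subsingleton_congr
  rw [h1, ← ModuleCat.isZero_iff_subsingleton,
    ← HomologicalComplex.exactAt_iff_isZero_homology,
    HomologicalComplex.exactAt_iff' _ i (i + 1) (i + 2) (by simp) (by simp),
    ShortComplex.moduleCat_exact_iff]
  exact Iff.rfl

lemma subsingleton_derived_ext_iff_abelian_ext {R : Type u} [CommRing R] (N M : ModuleCat.{u} R)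
    (i : ℕ) :
    Subsingleton (((Ext R (ModuleCat.{u} R) (i + 1)).obj (Opposite.op N)).obj M) ↔
      Subsingleton (Abelian.Ext N M (i + 1)) := by
  let P := projectiveResolution N
  rw [subsingleton_derived_ext_iff P M i, subsingleton_iff_forall_eq 0]
  constructor
  · intro h x
    obtain ⟨f, hf, rfl⟩ := P.extMk_surjective x (i + 2) rfl
    rw [P.extMk_eq_zero_iff f (i + 2) rfl hf i rfl]
    exact h f hf
  · intro h f hf
    rw [← P.extMk_eq_zero_iff f (i + 2) rfl hf i rfl]
    exact h _

lemma hasFiniteInjectiveDimension_iff {R : Type u} [CommRing R] (M : ModuleCat.{u} R) :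
    HasFiniteInjectiveDimension R M ↔ ∃ n : ℕ, HasInjectiveDimensionLE M n := by
  refine exists_congr fun n => ?_
  constructor
  · intro h
    refine hasInjectiveDimensionLT_of_enoughProjectives M (n + 1) fun N => ?_
    rw [← subsingleton_derived_ext_iff_abelian_ext]
    exact h N _ n.lt_succ_self
  · rintro h N (_ | i) hi
    · omega
    · rw [subsingleton_derived_ext_iff_abelian_ext]
      exact HasInjectiveDimensionLT.subsingleton M (n + 1) (i + 1) hi N

/-- The value of an element of a coextension of scalars. -/
def coextApply {R R' : Type u} [CommRing R] [CommRing R'] (φ : R →+* R') (M : ModuleCat.{u} R)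
    (h : (ModuleCat.coextendScalars.{u, u, u} φ).obj M) (r : R') : M :=
  ModuleCat.CoextendScalars.equiv φ M h r

section coextApply

variable {R R' : Type u} [CommRing R] [CommRing R'] (φ : R →+* R')

lemma coextApply_add_right (M : ModuleCat.{u} R)
    (h : (ModuleCat.coextendScalars.{u, u, u} φ).obj M) (r s : R') :
    coextApply φ M h (r + s) = coextApply φ M h r + coextApply φ M h s :=
  (ModuleCat.CoextendScalars.equiv φ M h).map_add r s

lemma coextApply_map_mul (M : ModuleCat.{u} R)
    (h : (ModuleCat.coextendScalars.{u, u, u} φ).obj M) (a : R) (r : R') :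
    coextApply φ M h (φ a * r) = a • coextApply φ M h r :=
  (ModuleCat.CoextendScalars.equiv φ M h).map_smul a r

lemma coextApply_zero_right (M : ModuleCat.{u} R)
    (h : (ModuleCat.coextendScalars.{u, u, u} φ).obj M) : coextApply φ M h 0 = 0 :=
  (ModuleCat.CoextendScalars.equiv φ M h).map_zero

lemma coextApply_add (M : ModuleCat.{u} R)
    (h k : (ModuleCat.coextendScalars.{u, u, u} φ).obj M) (r : R') :
    coextApply φ M (h + k) r = coextApply φ M h r + coextApply φ M k r :=
  rfl

lemma coextApply_smul (M : ModuleCat.{u} R)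
    (h : (ModuleCat.coextendScalars.{u, u, u} φ).obj M) (r s : R') :
    coextApply φ M (s • h) r = coextApply φ M h (r * s) :=
  rfl

lemma coextApply_map {M N : ModuleCat.{u} R} (g : M ⟶ N)
    (h : (ModuleCat.coextendScalars.{u, u, u} φ).obj M) (r : R') :
    coextApply φ N ((ModuleCat.coextendScalars.{u, u, u} φ).map g h) r =
      g.hom (coextApply φ M h r) :=
  rfl

lemma coextApply_injective (M : ModuleCat.{u} R)
    {h k : (ModuleCat.coextendScalars.{u, u, u} φ).obj M}
    (hk : ∀ r, coextApply φ M h r = coextApply φ M k r) : h = k :=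
  ModuleCat.CoextendScalars.ext (LinearMap.ext hk)

lemma exists_coextApply_eq (M : ModuleCat.{u} R) (f : R' → M)
    (hadd : ∀ r s, f (r + s) = f r + f s) (hsmul : ∀ a r, f (φ a * r) = a • f r) :
    ∃ h, coextApply φ M h = f :=
  ⟨(ModuleCat.CoextendScalars.equiv φ M).symm
    { toFun := f, map_add' := hadd, map_smul' := hsmul }, rfl⟩

end coextApply

lemma hasInjectiveDimensionLE_zero_iff_injective {R : Type u} [CommRing R] (M : ModuleCat.{u} R) :
    HasInjectiveDimensionLE M 0 ↔ Injective M :=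
  injective_iff_hasInjectiveDimensionLT_one.symm

/-- Coextension of scalars does not raise the injective dimension of modules satisfying `Q`, if
it is exact on the injective copresentations of such modules and `Q` passes to cosyzygies. -/
lemma hasInjectiveDimensionLE_coextendScalars {A R : Type u} [CommRing A] [CommRing R]
    (φ : A →+* R) (Q : ModuleCat.{u} A → Prop)
    (hQ : ∀ S : ShortComplex (ModuleCat.{u} A), S.ShortExact → Injective S.X₂ → Q S.X₁ →
      Q S.X₃ ∧ Epi ((ModuleCat.coextendScalars.{u, u, u} φ).map S.g))
    (n : ℕ) (M : ModuleCat.{u} A) (hM : Q M) (h : HasInjectiveDimensionLE M n) :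
    HasInjectiveDimensionLE ((ModuleCat.coextendScalars.{u, u, u} φ).obj M) n := by
  let adj := ModuleCat.restrictCoextendScalarsAdj.{u, u, u} φ
  induction n generalizing M with
  | zero =>
    rw [hasInjectiveDimensionLE_zero_iff_injective] at h ⊢
    exact adj.map_injective _ h
  | succ n ih =>
    obtain ⟨I, inj, f, monof⟩ := EnoughInjectives.presentation M
    let T := ShortComplex.mk f (Limits.cokernel.π f) (Limits.cokernel.condition f)
    have hT : T.ShortExact := { exact := ShortComplex.exact_cokernel f }
    obtain ⟨h3, hepi⟩ := hQ T hT inj hM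
    have hC : HasInjectiveDimensionLE T.X₃ n := (hT.hasInjectiveDimensionLT_X₃_iff n inj).mpr h
    have hT' : (T.map (ModuleCat.coextendScalars.{u, u, u} φ)).ShortExact :=
      { exact := hT.exact.map_of_mono_of_preservesKernel _ monof
          (adj.rightAdjoint_preservesLimits.{0, 0}.preservesLimitsOfShape.preservesLimit)
        mono_f := by
          rw [ModuleCat.mono_iff_injective]
          intro h k hk
          refine coextApply_injective φ _ fun r => (ModuleCat.mono_iff_injective f).mp monof ?_
          exact congrArg (fun t => coextApply φ I t r) hk
        epi_g := hepi }
    have hI : Injective (T.map (ModuleCat.coextendScalars.{u, u, u} φ)).X₂ :=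
      adj.map_injective _ inj
    exact (hT'.hasInjectiveDimensionLT_X₃_iff n hI).mp (ih _ h3 hC)

lemma hasInjectiveDimensionLE_coextendScalars_of_projective {A R : Type u} [CommRing A]
    [CommRing R] [Algebra A R] [Module.Projective A R] (n : ℕ) (M : ModuleCat.{u} A)
    (h : HasInjectiveDimensionLE M n) :
    HasInjectiveDimensionLE
      ((ModuleCat.coextendScalars.{u, u, u} (algebraMap A R)).obj M) n := by
  refine hasInjectiveDimensionLE_coextendScalars _ (fun _ => True) (fun S hS _ _ => ⟨trivial, ?_⟩)
    n M trivial h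
  rw [ModuleCat.epi_iff_surjective]
  intro k
  have hg : Function.Surjective S.g.hom := (ModuleCat.epi_iff_surjective _).mp hS.epi_g
  let k' : R →ₗ[A] S.X₃ :=
    { toFun := coextApply _ _ k
      map_add' := coextApply_add_right _ _ k
      map_smul' := fun a b => by
        rw [Algebra.smul_def]
        exact coextApply_map_mul _ _ k a b }
  obtain ⟨l, hl⟩ := Module.projective_lifting_property S.g.hom k' hg
  obtain ⟨l', hl'⟩ := exists_coextApply_eq (algebraMap A R) S.X₂ l (map_add l) fun a r => by
    rw [← Algebra.smul_def, map_smul]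
  refine ⟨l', coextApply_injective _ _ fun r => ?_⟩
  rw [coextApply_map, hl']
  exact LinearMap.congr_fun hl r

lemma exists_smul_eq_of_injective {R : Type u} [CommRing R] {x : R} (hx : ∀ a, x * a = 0 → a = 0)
    (I : ModuleCat.{u} R) [Injective I] (i : I) : ∃ j : I, x • j = i := by
  have : Module.Injective R I := Module.injective_module_of_injective_object R I
  have hinj : Function.Injective (LinearMap.toSpanSingleton R R x) := by
    rw [injective_iff_map_eq_zero]
    intro a ha
    exact hx a (by simpa [mul_comm] using ha)
  obtain ⟨h, hh⟩ := Module.Injective.out (LinearMap.toSpanSingleton R R x) hinj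
    (LinearMap.toSpanSingleton R I i)
  refine ⟨h 1, ?_⟩
  have := hh 1
  rw [← map_smul]
  simpa using this

/-- The element of `Hom_R(R', M)` determined by an element of `M` killed by the kernel. -/
lemma exists_coextendScalars_apply_one {R R' : Type u} [CommRing R] [CommRing R'] {φ : R →+* R'}
    (hφ : Function.Surjective φ) {x : R} (hker : RingHom.ker φ = Ideal.span {x})
    (M : ModuleCat.{u} R) (m : M) (hm : x • m = 0) :
    ∃ h : (ModuleCat.coextendScalars.{u, u, u} φ).obj M,
      coextApply φ M h 1 = m := by
  have hk : ∀ a b : R, φ a = φ b → a • m = b • m := by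
    intro a b hab
    have : a - b ∈ RingHom.ker φ := by simp [RingHom.mem_ker, hab]
    rw [hker, Ideal.mem_span_singleton'] at this
    obtain ⟨c, hc⟩ := this
    rw [← sub_eq_zero, ← sub_smul, ← hc, mul_smul, hm, smul_zero]
  obtain ⟨h, hh⟩ := exists_coextApply_eq φ M (fun r => (hφ r).choose • m)
    (fun a b => by
      rw [← add_smul]
      refine hk _ _ ?_
      rw [map_add, (hφ a).choose_spec, (hφ b).choose_spec, (hφ (a + b)).choose_spec])
    (fun a b => by
      rw [← mul_smul]
      refine hk _ _ ?_
      rw [map_mul, (hφ b).choose_spec, (hφ (φ a * b)).choose_spec])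
  refine ⟨h, ?_⟩
  rw [hh]
  change (hφ 1).choose • m = m
  rw [hk _ 1 (by rw [(hφ 1).choose_spec, map_one]), one_smul]

lemma smul_coextendScalars_apply_one {R R' : Type u} [CommRing R] [CommRing R'] {φ : R →+* R'}
    {x : R} (hx : φ x = 0) (M : ModuleCat.{u} R)
    (h : (ModuleCat.coextendScalars.{u, u, u} φ).obj M) :
    x • coextApply φ M h 1 = 0 := by
  rw [← coextApply_map_mul, hx, zero_mul, coextApply_zero_right]

lemma hasInjectiveDimensionLE_coextendScalars_of_divisible {R R' : Type u} [CommRing R]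
    [CommRing R'] {φ : R →+* R'} (hφ : Function.Surjective φ) {x : R}
    (hker : RingHom.ker φ = Ideal.span {x}) (hx : ∀ a, x * a = 0 → a = 0)
    (n : ℕ) (M : ModuleCat.{u} R) (hM : ∀ m : M, ∃ m' : M, x • m' = m)
    (h : HasInjectiveDimensionLE M n) :
    HasInjectiveDimensionLE ((ModuleCat.coextendScalars.{u, u, u} φ).obj M) n := by
  have hφx : φ x = 0 := by
    rw [← RingHom.mem_ker, hker]; exact Ideal.mem_span_singleton_self x
  refine hasInjectiveDimensionLE_coextendScalars φ (fun M => ∀ m : M, ∃ m' : M, x • m' = m)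
    (fun S hS hI hM => ?_) n M hM h
  have hg : Function.Surjective S.g.hom := (ModuleCat.epi_iff_surjective _).mp hS.epi_g
  have hex : Function.Exact S.f.hom S.g.hom :=
    (ShortComplex.ShortExact.moduleCat_exact_iff_function_exact _).mp hS.exact
  refine ⟨fun c => ?_, ?_⟩
  · obtain ⟨i, rfl⟩ := hg c
    obtain ⟨j, rfl⟩ := exists_smul_eq_of_injective hx S.X₂ i
    exact ⟨S.g.hom j, (map_smul _ _ _).symm⟩
  · rw [ModuleCat.epi_iff_surjective]
    intro k
    obtain ⟨i, hi⟩ := hg (coextApply φ S.X₃ k 1)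
    have h0 : S.g.hom (x • i) = 0 := by
      rw [map_smul, hi, smul_coextendScalars_apply_one hφx]
    obtain ⟨m, hm⟩ := (hex _).mp h0
    obtain ⟨m', rfl⟩ := hM m
    have h1 : x • (i - S.f.hom m') = 0 := by rw [smul_sub, ← hm, map_smul, sub_self]
    obtain ⟨l, hl⟩ := exists_coextendScalars_apply_one hφ hker S.X₂ _ h1
    refine ⟨l, ?_⟩
    have h2 : S.g.hom (coextApply φ S.X₂ l 1) = coextApply φ S.X₃ k 1 := by
      rw [hl, map_sub, hi, (hex _).mpr ⟨m', rfl⟩, sub_zero]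
    refine coextApply_injective φ _ fun r => ?_
    obtain ⟨a, rfl⟩ := hφ r
    rw [← mul_one (φ a), coextApply_map_mul, coextApply_map_mul, ← h2, coextApply_map]

/-- Finite self-injective dimension passes to the quotient by a nonzerodivisor. -/
lemma exists_hasInjectiveDimensionLE_of_surjective {R R' : Type u} [CommRing R]
    [CommRing R'] {φ : R →+* R'} (hφ : Function.Surjective φ) {x : R}
    (hker : RingHom.ker φ = Ideal.span {x}) (hx : ∀ a, x * a = 0 → a = 0)
    (h : ∃ n, HasInjectiveDimensionLE (ModuleCat.of R R) n) :
    ∃ n, HasInjectiveDimensionLE (ModuleCat.of R' R') n := by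
  obtain ⟨n, hn⟩ := h
  have hφx : φ x = 0 := by
    rw [← RingHom.mem_ker, hker]; exact Ideal.mem_span_singleton_self x
  obtain ⟨I, inj, f, monof⟩ := EnoughInjectives.presentation (ModuleCat.of R R)
  let S := ShortComplex.mk f (Limits.cokernel.π f) (Limits.cokernel.condition f)
  have hS : S.ShortExact := { exact := ShortComplex.exact_cokernel f }
  have hC : HasInjectiveDimensionLE S.X₃ n :=
    (hS.hasInjectiveDimensionLT_X₃_iff n inj).mpr
      (hasInjectiveDimensionLT_of_ge _ _ _ (Nat.le_succ _))
  have hg : Function.Surjective S.g.hom := (ModuleCat.epi_iff_surjective _).mp hS.epi_g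
  have hf : Function.Injective S.f.hom := (ModuleCat.mono_iff_injective _).mp hS.mono_f
  have hex : Function.Exact S.f.hom S.g.hom :=
    (ShortComplex.ShortExact.moduleCat_exact_iff_function_exact _).mp hS.exact
  have hdiv : ∀ m : S.X₃, ∃ m' : S.X₃, x • m' = m := by
    intro c
    obtain ⟨i, rfl⟩ := hg c
    obtain ⟨j, rfl⟩ := exists_smul_eq_of_injective hx I i
    exact ⟨S.g.hom j, (map_smul _ _ _).symm⟩
  have hco := hasInjectiveDimensionLE_coextendScalars_of_divisible hφ hker hx n S.X₃ hdiv hC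
  let E := (ModuleCat.coextendScalars.{u, u, u} φ).obj S.X₃
  let ev : E → S.X₃ := fun k => coextApply φ S.X₃ k 1
  have ev_add : ∀ k l, ev (k + l) = ev k + ev l := fun k l => rfl
  have ev_smul : ∀ (a : R) k, ev (φ a • k) = a • ev k := by
    intro a k
    change coextApply φ S.X₃ (φ a • k) 1 = a • coextApply φ S.X₃ k 1
    rw [coextApply_smul, mul_comm, coextApply_map_mul]
  have hexist : ∀ k : E, ∃ r' : R', ∃ (i : I) (r : R), S.g.hom i = ev k ∧
      x • i = S.f.hom r ∧ φ r = r' := by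
    intro k
    obtain ⟨i, hi⟩ := hg (ev k)
    have h0 : S.g.hom (x • i) = 0 := by
      rw [map_smul, hi]
      exact smul_coextendScalars_apply_one hφx _ _
    obtain ⟨m, hm⟩ := (hex _).mp h0
    exact ⟨φ m, i, m, hi, hm.symm, rfl⟩
  have huniq : ∀ (k : E) (r' s' : R'), (∃ (i : I) (r : R), S.g.hom i = ev k ∧
      x • i = S.f.hom r ∧ φ r = r') → (∃ (i : I) (r : R), S.g.hom i = ev k ∧
      x • i = S.f.hom r ∧ φ r = s') → r' = s' := by
    rintro k _ _ ⟨i, r, hi, hr, rfl⟩ ⟨j, s, hj, hs, rfl⟩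
    have h0 : S.g.hom (i - j) = 0 := by rw [map_sub, hi, hj, sub_self]
    obtain ⟨m, hm⟩ := (hex _).mp h0
    have h1 : S.f.hom (x • m) = S.f.hom (r - s) := by
      rw [map_smul, hm, map_sub, smul_sub, hr, hs]
    have h2 : x • m = r - s := hf h1
    have h3 : φ (r - s) = 0 := by
      rw [← h2]
      change φ (x * m) = 0
      rw [map_mul, hφx, zero_mul]
    rw [map_sub] at h3
    exact sub_eq_zero.mp h3
  let s : E →ₗ[R'] R' :=
    { toFun := fun k => (hexist k).choose
      map_add' := fun k l => by
        obtain ⟨i, r, hi, hr, hr'⟩ := (hexist k).choose_spec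
        obtain ⟨j, t, hj, ht, ht'⟩ := (hexist l).choose_spec
        refine huniq (k + l) _ _ (hexist (k + l)).choose_spec ⟨i + j, r + t, ?_, ?_, ?_⟩
        · rw [map_add, hi, hj, ev_add]
        · rw [smul_add, hr, ht, ← map_add]
        · rw [map_add, hr', ht']
      map_smul' := fun a k => by
        obtain ⟨i, r, hi, hr, hr'⟩ := (hexist k).choose_spec
        obtain ⟨b, rfl⟩ := hφ a
        refine huniq (φ b • k) _ _ (hexist (φ b • k)).choose_spec ⟨b • i, b • r, ?_, ?_, ?_⟩
        · rw [map_smul, hi, ev_smul]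
        · rw [smul_comm, hr, ← map_smul]
        · change φ (b * r) = _
          rw [map_mul, hr']; rfl }
  obtain ⟨i, hi⟩ := exists_smul_eq_of_injective hx I (S.f.hom (1 : R))
  have h0 : x • S.g.hom i = 0 := by
    rw [← map_smul, hi]
    exact (hex _).mpr ⟨1, rfl⟩
  obtain ⟨k, hk⟩ := exists_coextendScalars_apply_one hφ hker S.X₃ _ h0
  have hsk : s k = 1 :=
    huniq k _ _ (hexist k).choose_spec ⟨i, 1, hk.symm, hi, map_one φ⟩
  let ret : Retract (ModuleCat.of R' R') E :=
    { i := ModuleCat.ofHom (LinearMap.toSpanSingleton R' E k)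
      r := ModuleCat.ofHom s
      retract := by
        ext
        change s ((1 : R') • k) = 1
        rw [one_smul, hsk] }
  exact ⟨n, ret.hasInjectiveDimensionLT _⟩

lemma forall_hasInjectiveDimensionLE_polynomial {B : Type u} [CommRing B] {d : ℕ}
    (h : ∀ N : ModuleCat.{u} B, HasInjectiveDimensionLE N d) (N : ModuleCat.{u} (Polynomial B)) :
    HasInjectiveDimensionLE N (d + 1) := by
  let _ : Module B N := Module.compHom N (algebraMap B (Polynomial B))
  have smul_def : ∀ (b : B) (m : N), b • m = algebraMap B (Polynomial B) b • m :=
    fun _ _ => rfl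
  let M : ModuleCat.{u} B := ModuleCat.of B N
  let φ := algebraMap B (Polynomial B)
  let E := (ModuleCat.coextendScalars.{u, u, u} φ).obj M
  have hE : HasInjectiveDimensionLE E d :=
    hasInjectiveDimensionLE_coextendScalars_of_projective d M (h M)
  let xM : M ⟶ M := ModuleCat.ofHom
    { toFun := fun m : N => (Polynomial.X : Polynomial B) • m
      map_add' := fun m m' => smul_add _ _ _
      map_smul' := fun b m => by
        rw [RingHom.id_apply, smul_def, smul_def, smul_smul, smul_smul, mul_comm] }
  let g : E →ₗ[Polynomial B] E := (Polynomial.X : Polynomial B) • LinearMap.id -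
    ((ModuleCat.coextendScalars.{u, u, u} φ).map xM).hom
  have hg : ∀ (k : E) (r : Polynomial B), coextApply φ M (g k) r =
      coextApply φ M k (r * Polynomial.X) - (Polynomial.X : Polynomial B) •
        (coextApply φ M k r : N) := fun _ _ => rfl
  have hf : ∀ m : N, ∃ k : E, coextApply φ M k = fun r => (r • m : N) := fun m =>
    exists_coextApply_eq φ M _ (fun r s => add_smul _ _ _) (fun a r => mul_smul _ _ _)
  choose f hf using hf
  have hf' : ∀ (m : N) (r : Polynomial B), coextApply φ M (f m) r = (r • m : N) :=
    fun m r => congrFun (hf m) r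
  let f' : N →ₗ[Polynomial B] E :=
    { toFun := f
      map_add' := fun m m' => coextApply_injective φ M fun r => by
        rw [coextApply_add, hf', hf', hf']
        exact smul_add _ _ _
      map_smul' := fun a m => coextApply_injective φ M fun r => by
        rw [RingHom.id_apply, coextApply_smul, hf', hf']
        exact smul_smul _ _ _ }
  have hzero : ∀ m, g (f' m) = 0 := fun m => coextApply_injective φ M fun r => by
    rw [hg]
    change coextApply φ M (f m) (r * Polynomial.X) -
      (Polynomial.X : Polynomial B) • (coextApply φ M (f m) r : N) = (0 : N)
    rw [hf', hf', smul_smul, mul_comm, sub_self]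
  let S : ShortComplex (ModuleCat.{u} (Polynomial B)) :=
    ShortComplex.mk (ModuleCat.ofHom f') (ModuleCat.ofHom g) (ModuleCat.hom_ext (LinearMap.ext hzero))
  have hS : S.ShortExact :=
    { exact := by
        rw [ShortComplex.moduleCat_exact_iff]
        intro k hk
        have hk' : ∀ r, coextApply φ M k (r * Polynomial.X) = (Polynomial.X : Polynomial B) •
            (coextApply φ M k r : N) := fun r => by
          rw [← sub_eq_zero, ← hg]
          exact congrArg (fun t => coextApply φ M t r) hk
        refine ⟨(coextApply φ M k 1 : N), coextApply_injective φ M fun r => ?_⟩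
        refine (hf' _ _).trans ?_
        induction r using Polynomial.induction_on' with
        | add p q hp hq => rw [add_smul, hp, hq, coextApply_add_right]
        | monomial i b =>
          rw [← Polynomial.C_mul_X_pow_eq_monomial]
          refine Eq.trans ?_ (coextApply_map_mul φ M k b _).symm
          refine (mul_smul _ _ _).trans (congrArg (fun t : N => (Polynomial.C b) • t) ?_)
          induction i with
          | zero => rw [pow_zero, one_smul]
          | succ i ih => rw [pow_succ, hk', ← ih, smul_smul, mul_comm]
      mono_f := by
        rw [ModuleCat.mono_iff_injective]
        intro m m' hm
        have := congrArg (fun t => coextApply φ M t 1) hm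
        replace this : coextApply φ M (f m) 1 = coextApply φ M (f m') 1 := this
        rwa [hf', hf', one_smul, one_smul] at this
      epi_g := by
        rw [ModuleCat.epi_iff_surjective]
        intro k
        let s : ℕ → N := fun i => Nat.rec (motive := fun _ => N) 0
          (fun i t => (Polynomial.X : Polynomial B) • t +
            (coextApply φ M k (Polynomial.X ^ i) : N)) i
        let L : Polynomial B →ₗ[B] N := Polynomial.lsum fun i =>
          LinearMap.toSpanSingleton B N (s i)
        have hL : ∀ b i, L (Polynomial.C b * Polynomial.X ^ i) = b • s i := fun b i => by
          rw [Polynomial.C_mul_X_pow_eq_monomial]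
          simp [L, Polynomial.lsum_apply]
        obtain ⟨l, hl⟩ := exists_coextApply_eq φ M L (map_add L) fun a r => by
          rw [← Algebra.smul_def, map_smul]
        refine ⟨l, coextApply_injective φ M fun r => (hg l r).trans ?_⟩
        rw [hl]
        induction r using Polynomial.induction_on' with
        | add p q hp hq =>
          rw [coextApply_add_right, ← hp, ← hq, add_mul, map_add, map_add]
          refine Eq.trans ?_ (sub_add_sub_comm _ _ _ _).symm
          congr 1
          exact smul_add _ _ _
        | monomial i b =>
          rw [← Polynomial.C_mul_X_pow_eq_monomial, mul_assoc, ← pow_succ]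
          refine Eq.trans ?_ (coextApply_map_mul φ M k b _).symm
          have h1 : s (i + 1) = (Polynomial.X : Polynomial B) • s i +
            (coextApply φ M k (Polynomial.X ^ i) : N) := rfl
          rw [hL, hL, h1, smul_add, smul_def, smul_def b (s i), smul_smul, smul_smul, mul_comm,
            add_sub_cancel_left] }
  exact hS.hasInjectiveDimensionLT_X₁ (d + 1) hE (hasInjectiveDimensionLT_of_ge _ _ _ (Nat.le_succ _))

lemma forall_hasInjectiveDimensionLE_of_ringEquiv {A B : Type u} [CommRing A] [CommRing B]
    (e : A ≃+* B) {d : ℕ} (h : ∀ N : ModuleCat.{u} A, HasInjectiveDimensionLE N d)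
    (N : ModuleCat.{u} B) : HasInjectiveDimensionLE N d := by
  let _ : Module A N := Module.compHom N (e : A →+* B)
  have := RingHomInvPair.of_ringEquiv e
  have := RingHomInvPair.of_ringEquiv_symm e
  let M : ModuleCat.{u} A := ModuleCat.of A N
  let e' : M ≃ₛₗ[RingHomClass.toRingHom e] N :=
    { AddEquiv.refl N with map_smul' := fun _ _ => rfl }
  exact (ModuleCat.hasInjectiveDimensionLE_iff_of_semiLinearEquiv e e' d).mp (h M)

lemma forall_hasInjectiveDimensionLE_field (F : Type u) [Field F] (N : ModuleCat.{u} F) :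
    HasInjectiveDimensionLE N 0 := by
  rw [hasInjectiveDimensionLE_zero_iff_injective]
  have := Module.injective_of_isSemisimpleRing F N
  exact Module.injective_object_of_injective_module F N

lemma forall_hasInjectiveDimensionLE_mvPolynomial (F : Type u) [Field F] (n : ℕ)
    (N : ModuleCat.{u} (MvPolynomial (Fin n) F)) : HasInjectiveDimensionLE N n := by
  induction n with
  | zero =>
    exact forall_hasInjectiveDimensionLE_of_ringEquiv
      (MvPolynomial.isEmptyAlgEquiv F (Fin 0)).symm.toRingEquiv
      (forall_hasInjectiveDimensionLE_field F) N
  | succ n ih =>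
    exact forall_hasInjectiveDimensionLE_of_ringEquiv
      (MvPolynomial.finSuccEquiv F n).symm.toRingEquiv
      (forall_hasInjectiveDimensionLE_polynomial ih) N

lemma exists_hasInjectiveDimensionLE_iff_of_ringEquiv {R R' : Type u} [CommRing R] [CommRing R']
    (e : R ≃+* R') : (∃ n, HasInjectiveDimensionLE (ModuleCat.of R R) n) ↔
      ∃ n, HasInjectiveDimensionLE (ModuleCat.of R' R') n := by
  have := RingHomInvPair.of_ringEquiv e
  have := RingHomInvPair.of_ringEquiv_symm e
  let e' : ModuleCat.of R R ≃ₛₗ[RingHomClass.toRingHom e] ModuleCat.of R' R' :=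
    { e.toAddEquiv with map_smul' := fun a b => map_mul e a b }
  exact exists_congr (ModuleCat.hasInjectiveDimensionLE_iff_of_semiLinearEquiv e e')

lemma IsGorensteinRing.of_ringEquiv {R R' : Type u} [CommRing R] [CommRing R']
    (e : R ≃+* R') (h : IsGorensteinRing R) : IsGorensteinRing R' := by
  have := h.1
  refine ⟨isNoetherianRing_of_ringEquiv R e, fun P hP => ?_⟩
  have h2 := h.2 (P.comap (e : R →+* R'))
  rw [hasFiniteInjectiveDimension_iff] at h2 ⊢
  refine (exists_hasInjectiveDimensionLE_iff_of_ringEquiv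
    (IsLocalization.ringEquivOfRingEquiv (M := (P.comap (e : R →+* R')).primeCompl)
      (T := P.primeCompl) _ _ e ?_)).mp h2
  ext x
  constructor
  · rintro ⟨y, hy, rfl⟩
    exact hy
  · intro hx
    refine ⟨e.symm x, fun hx' => hx ?_, e.apply_symm_apply x⟩
    simpa using hx'

/-- A Noetherian ring with a Frobenius form over a subring of finite self-injective dimension. -/
lemma isGorensteinRing_of_frobenius {A R : Type u} [CommRing A] [CommRing R] [Algebra A R]
    [IsNoetherianRing R] [Module.Projective A R] (n : ℕ)
    (hA : HasInjectiveDimensionLE (ModuleCat.of A A) n) (φ : R →ₗ[A] A)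
    (hinj : ∀ r, (∀ s, φ (s * r) = 0) → r = 0)
    (hsurj : ∀ ψ : R →ₗ[A] A, ∃ r, ∀ s, ψ s = φ (s * r)) : IsGorensteinRing R := by
  let E := (ModuleCat.coextendScalars.{u, u, u} (algebraMap A R)).obj (ModuleCat.of A A)
  have hE : HasInjectiveDimensionLE E n := hasInjectiveDimensionLE_coextendScalars_of_projective _ _ hA
  have hf : ∀ r : R, ∃ k : E, coextApply (algebraMap A R) (ModuleCat.of A A) k =
      fun s => φ (s * r) := fun r =>
    exists_coextApply_eq _ _ _ (fun s t => by rw [add_mul, map_add])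
      (fun a s => by rw [mul_assoc, ← Algebra.smul_def, map_smul])
  choose f hf using hf
  have hf' : ∀ r s, coextApply (algebraMap A R) (ModuleCat.of A A) (f r) s = φ (s * r) :=
    fun r s => congrFun (hf r) s
  let f' : R →ₗ[R] E :=
    { toFun := f
      map_add' := fun r s => coextApply_injective _ _ fun t => by
        rw [coextApply_add, hf', hf', hf', mul_add, map_add]
      map_smul' := fun r s => coextApply_injective _ _ fun t => by
        rw [RingHom.id_apply, coextApply_smul, hf', hf', smul_eq_mul, mul_assoc] }
  have hbij : Function.Bijective f' := by
    constructor
    · rw [injective_iff_map_eq_zero]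
      intro r hr
      refine hinj r fun s => ?_
      rw [← hf']
      exact congrArg (fun t => coextApply (algebraMap A R) (ModuleCat.of A A) t s) hr
    · intro k
      obtain ⟨r, hr⟩ := hsurj
        { toFun := coextApply (algebraMap A R) (ModuleCat.of A A) k
          map_add' := coextApply_add_right _ _ k
          map_smul' := fun a s => by
            rw [Algebra.smul_def]
            exact coextApply_map_mul _ _ k a s }
      refine ⟨r, coextApply_injective _ _ fun s => ?_⟩
      exact (hf' r s).trans (hr s).symm
  have hR : HasInjectiveDimensionLE (ModuleCat.of R R) n :=
    (ModuleCat.hasInjectiveDimensionLE_iff_of_linearEquiv (M := ModuleCat.of R R)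
      (LinearEquiv.ofBijective f' hbij) n).mpr hE
  refine ⟨inferInstance, fun P _ => ?_⟩
  rw [hasFiniteInjectiveDimension_iff]
  refine ⟨n, ?_⟩
  let M := ModuleCat.of R R
  have hP := M.localizedModule_hasInjectiveDimensionLE n P.primeCompl
  let g : M →ₗ[R] ModuleCat.of (Localization.AtPrime P) (Localization.AtPrime P) :=
    Algebra.linearMap R (Localization.AtPrime P)
  have hg : IsLocalizedModule P.primeCompl g :=
    inferInstanceAs (IsLocalizedModule P.primeCompl (Algebra.linearMap R (Localization.AtPrime P)))
  have h1 : IsLocalizedModule P.primeCompl (M.localizedModuleMkLinearMap P.primeCompl) :=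
    M.localizedModule_isLocalizedModule P.primeCompl
  exact (ModuleCat.hasInjectiveDimensionLE_iff_of_linearEquiv
    ((IsLocalizedModule.linearEquiv P.primeCompl (M.localizedModuleMkLinearMap P.primeCompl)
      g).extendScalarsOfIsLocalization P.primeCompl (Localization.AtPrime P)) n).mp hP

/-- The embedding of the residue field given by a socle element. -/
lemma exists_residue_linearMap {L : Type u} [CommRing L] (I : Ideal L) [I.IsMaximal] (s : L)
    (hs : ∀ t ∈ I, t * s = 0) : ∃ σ : (L ⧸ I) →ₗ[L] L, σ 1 = s ∧ (s ≠ 0 → Function.Injective σ) := by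
  let σ : (L ⧸ I) →ₗ[L] L := Submodule.liftQ I (LinearMap.toSpanSingleton L L s) (fun t ht => by
    simpa using hs t ht)
  have hσ : ∀ t, σ (Ideal.Quotient.mk I t) = t * s := fun t => by
    change Submodule.liftQ I _ _ (Submodule.Quotient.mk t) = _
    rw [Submodule.liftQ_apply]
    simp
  refine ⟨σ, by rw [← map_one (Ideal.Quotient.mk I), hσ, one_mul], fun hs0 => ?_⟩
  rw [injective_iff_map_eq_zero]
  intro a ha
  obtain ⟨t, rfl⟩ := Ideal.Quotient.mk_surjective a
  rw [hσ] at ha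
  rw [Ideal.Quotient.eq_zero_iff_mem]
  by_contra ht
  obtain ⟨c, i, hi, hc⟩ := Ideal.IsMaximal.exists_inv ‹_› ht
  refine hs0 ?_
  rw [← one_mul s, ← hc, add_mul, mul_assoc, ha, hs i hi, mul_zero, add_zero]

lemma exists_linearMap_finsupp_injective {L : Type u} [CommRing L] (I : Ideal L) [I.IsMaximal]
    {s : L} (hs0 : s ≠ 0) (hs : ∀ t ∈ I, t * s = 0) (V : Type u) [AddCommGroup V] [Module L V]
    (hV : ∀ t ∈ I, ∀ v : V, t • v = 0) :
    ∃ (ι : Type u) (f : V →ₗ[L] ι →₀ L), Function.Injective f := by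
  obtain ⟨σ, -, hσ⟩ := exists_residue_linearMap I s hs
  have htors : Module.IsTorsionBySet L V I := fun v t => hV t.1 t.2 v
  let _ : Module (L ⧸ I) V := htors.module
  have : IsScalarTower L (L ⧸ I) V := htors.isScalarTower
  let _ : Field (L ⧸ I) := Ideal.Quotient.field I
  let b := Module.Basis.ofVectorSpace (L ⧸ I) V
  refine ⟨_, (Finsupp.mapRange.linearMap σ).comp (b.repr.toLinearMap.restrictScalars L), ?_⟩
  refine (Finsupp.mapRange_injective _ (map_zero σ) (hσ hs0)).comp b.repr.injective

lemma hasInjectiveDimensionLE_pred_of_pow_eq_bot {L : Type u} [CommRing L] (I : Ideal L)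
    [I.IsMaximal] {s : L} (hs0 : s ≠ 0) (hs : ∀ t ∈ I, t * s = 0) {N : ℕ} (hN : I ^ N = ⊥)
    {n : ℕ} (hL : HasInjectiveDimensionLE (ModuleCat.of L L) (n + 1)) :
    HasInjectiveDimensionLE (ModuleCat.of L L) n := by
  have key : ∀ V : ModuleCat.{u} L, (∀ t ∈ I, ∀ v : V, t • v = 0) →
      Subsingleton (Abelian.Ext V (ModuleCat.of L L) (n + 1)) := by
    intro V hV
    obtain ⟨ι, f, hf⟩ := exists_linearMap_finsupp_injective I hs0 hs V hV
    let S : ShortComplex (ModuleCat.{u} L) :=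
      ModuleCat.shortComplexOfCompEqZero _ _ f.exact_map_mkQ_range.linearMap_comp_eq_zero
    have hS : S.ShortExact := ModuleCat.shortComplex_shortExact S
      f.exact_map_mkQ_range hf (Submodule.mkQ_surjective _)
    refine subsingleton_of_forall_eq 0 fun x => ?_
    have h2 : Subsingleton (Abelian.Ext S.X₃ (ModuleCat.of L L) (n + 2)) :=
      HasInjectiveDimensionLT.subsingleton (ModuleCat.of L L) (n + 2) (n + 2) le_rfl _
    obtain ⟨y, rfl⟩ := Abelian.Ext.contravariant_sequence_exact₁ hS _ x (by omega)
      (Subsingleton.elim (α := Abelian.Ext S.X₃ (ModuleCat.of L L) (n + 2)) _ _)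
    have hproj : Projective S.X₂ :=
      (IsProjective.iff_projective (R := L) (P := ι →₀ L)).mp inferInstance
    rw [Abelian.Ext.eq_zero_of_projective y, Abelian.Ext.comp_zero]
  have main : ∀ (j : ℕ) (Y : ModuleCat.{u} L), (∀ t ∈ I ^ j, ∀ v : Y, t • v = 0) →
      Subsingleton (Abelian.Ext Y (ModuleCat.of L L) (n + 1)) := by
    intro j
    induction j with
    | zero => exact fun Y hY => key Y fun t _ v => hY t (by simp) v
    | succ j ih =>
      intro Y hY
      let P : Submodule L Y := I • ⊤
      let S : ShortComplex (ModuleCat.{u} L) :=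
        ModuleCat.shortComplexOfCompEqZero P.subtype P.mkQ
          (LinearMap.exact_subtype_mkQ P).linearMap_comp_eq_zero
      have hS : S.ShortExact := ModuleCat.shortComplex_shortExact S
        (LinearMap.exact_subtype_mkQ P) P.injective_subtype P.mkQ_surjective
      have h1 : Subsingleton (Abelian.Ext S.X₁ (ModuleCat.of L L) (n + 1)) := by
        refine ih _ fun t ht v => ?_
        obtain ⟨v, hv⟩ := v
        refine Subtype.ext ?_
        change t • v = 0
        refine Submodule.smul_induction_on hv (fun r hr y _ => ?_) (fun y z hy hz => ?_)
        · rw [smul_smul]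
          exact hY _ (by rw [pow_succ]; exact Ideal.mul_mem_mul ht hr) _
        · rw [smul_add, hy, hz, add_zero]
      have h3 : Subsingleton (Abelian.Ext S.X₃ (ModuleCat.of L L) (n + 1)) := by
        refine key _ fun t ht v => ?_
        obtain ⟨v, rfl⟩ := P.mkQ_surjective v
        rw [← map_smul]
        exact (Submodule.Quotient.mk_eq_zero P).mpr
          (Submodule.smul_mem_smul ht Submodule.mem_top)
      refine subsingleton_of_forall_eq 0 fun x => ?_
      obtain ⟨y, rfl⟩ := Abelian.Ext.contravariant_sequence_exact₂ hS _ x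
        (Subsingleton.elim (α := Abelian.Ext S.X₁ (ModuleCat.of L L) (n + 1)) _ _)
      rw [Subsingleton.elim y 0, Abelian.Ext.comp_zero]
  refine hasInjectiveDimensionLT_of_enoughProjectives _ (n + 1) fun Y => main N Y fun t ht v => ?_
  rw [hN, Ideal.mem_bot] at ht
  rw [ht, zero_smul]

/-- The socle of a local ring with nilpotent maximal ideal and finite self-injective dimension is
one-dimensional. -/
lemma exists_eq_mul_of_hasInjectiveDimensionLE {L : Type u} [CommRing L] (I : Ideal L)
    [I.IsMaximal] {a b : L} (ha0 : a ≠ 0) (ha : ∀ t ∈ I, t * a = 0) (hb : ∀ t ∈ I, t * b = 0)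
    {N : ℕ} (hN : I ^ N = ⊥) (hL : ∃ n, HasInjectiveDimensionLE (ModuleCat.of L L) n) :
    ∃ r, b = r * a := by
  obtain ⟨n, hn⟩ := hL
  have h0 : HasInjectiveDimensionLE (ModuleCat.of L L) 0 := by
    induction n with
    | zero => exact hn
    | succ n ih => exact ih (hasInjectiveDimensionLE_pred_of_pow_eq_bot I ha0 ha hN hn)
  rw [hasInjectiveDimensionLE_zero_iff_injective] at h0
  have : Module.Injective L L := Module.injective_module_of_injective_object L L
  obtain ⟨σ, hσ, hinj⟩ := exists_residue_linearMap I a ha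
  obtain ⟨τ, hτ, -⟩ := exists_residue_linearMap I b hb
  obtain ⟨h, hh⟩ := Module.Injective.out σ (hinj ha0) τ
  refine ⟨h 1, ?_⟩
  rw [← hτ, ← hh, hσ, mul_comm, ← smul_eq_mul, ← map_smul, smul_eq_mul, mul_one]

lemma exists_hasInjectiveDimensionLE_localization_quotient {R L : Type u} [CommRing R]
    [CommRing L] [Algebra R L] (S : Submonoid R) [IsLocalization S L] {I J : Ideal R} {x : R}
    (hJ : J = I ⊔ Ideal.span {x}) (hx : ∀ r, x * r ∈ I → r ∈ I)
    (h : ∃ n, HasInjectiveDimensionLE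
      (ModuleCat.of (L ⧸ I.map (algebraMap R L)) (L ⧸ I.map (algebraMap R L))) n) :
    ∃ n, HasInjectiveDimensionLE
      (ModuleCat.of (L ⧸ J.map (algebraMap R L)) (L ⧸ J.map (algebraMap R L))) n := by
  have hIJ : I.map (algebraMap R L) ≤ J.map (algebraMap R L) :=
    Ideal.map_mono (hJ ▸ le_sup_left)
  refine exists_hasInjectiveDimensionLE_of_surjective
    (φ := Ideal.Quotient.factor hIJ) (Ideal.Quotient.factor_surjective hIJ)
    (x := Ideal.Quotient.mk _ (algebraMap R L x)) ?_ ?_ h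
  · rw [Ideal.Quotient.factor_ker, hJ, Ideal.map_sup, Ideal.map_sup, Ideal.map_quotient_self,
      bot_sup_eq, Ideal.map_span, Ideal.map_span, Set.image_singleton, Set.image_singleton]
  · intro z hz
    obtain ⟨z, rfl⟩ := Ideal.Quotient.mk_surjective z
    rw [← map_mul, Ideal.Quotient.eq_zero_iff_mem] at hz
    rw [Ideal.Quotient.eq_zero_iff_mem]
    obtain ⟨⟨r, s⟩, hrs⟩ := IsLocalization.surj S z
    have h1 : algebraMap R L (x * r) ∈ I.map (algebraMap R L) := by
      rw [map_mul, ← hrs, ← mul_assoc]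
      exact Ideal.mul_mem_right _ _ hz
    rw [IsLocalization.algebraMap_mem_map_algebraMap_iff S] at h1
    obtain ⟨m, hm, hmr⟩ := h1
    rw [mul_left_comm] at hmr
    have h2 : algebraMap R L r ∈ I.map (algebraMap R L) := by
      rw [IsLocalization.algebraMap_mem_map_algebraMap_iff S]
      exact ⟨m, hm, hx _ hmr⟩
    rw [← hrs] at h2
    exact (Ideal.mul_unit_mem_iff_mem _ (IsLocalization.map_units L s)).mp h2

/-- Modulo a regular sequence of three elements generating an ideal primary to a maximal ideal,
the socle of a Gorenstein ring is generated by one element. -/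
lemma IsGorensteinRing.exists_mul_sub_mem {R : Type u} [CommRing R] (hR : IsGorensteinRing R)
    (𝔪 : Ideal R) [𝔪.IsMaximal] {J₁ J₂ J₃ : Ideal R} {x₀ x₁ x₂ : R}
    (hJ₁ : J₁ = ⊥ ⊔ Ideal.span {x₀}) (hJ₂ : J₂ = J₁ ⊔ Ideal.span {x₁})
    (hJ₃ : J₃ = J₂ ⊔ Ideal.span {x₂}) (h₀ : ∀ r, x₀ * r = 0 → r = 0)
    (h₁ : ∀ r, x₁ * r ∈ J₁ → r ∈ J₁) (h₂ : ∀ r, x₂ * r ∈ J₂ → r ∈ J₂)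
    {N : ℕ} (hN : 𝔪 ^ N ≤ J₃) {a b : R} (ha0 : ∀ t, t ∉ 𝔪 → t * a ∉ J₃)
    (ha : ∀ t ∈ 𝔪, t * a ∈ J₃) (hb : ∀ t ∈ 𝔪, t * b ∈ J₃) :
    ∃ t, t ∉ 𝔪 ∧ ∃ r, t * b - r * a ∈ J₃ := by
  let L := Localization.AtPrime 𝔪
  have hL := (hasFiniteInjectiveDimension_iff _).mp (hR.2 𝔪)
  have hbot : (⊥ : Ideal R).map (algebraMap R L) = ⊥ := Ideal.map_bot
  have hq : ∃ n, HasInjectiveDimensionLE (ModuleCat.of (L ⧸ (⊥ : Ideal R).map (algebraMap R L))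
      (L ⧸ (⊥ : Ideal R).map (algebraMap R L))) n := by
    rw [exists_hasInjectiveDimensionLE_iff_of_ringEquiv
      ((Ideal.quotEquivOfEq hbot).trans (RingEquiv.quotientBot L))]
    exact hL
  have hq₁ := exists_hasInjectiveDimensionLE_localization_quotient 𝔪.primeCompl hJ₁
    (fun r hr => h₀ r hr) hq
  have hq₂ := exists_hasInjectiveDimensionLE_localization_quotient 𝔪.primeCompl hJ₂ h₁ hq₁
  have hq₃ := exists_hasInjectiveDimensionLE_localization_quotient 𝔪.primeCompl hJ₃ h₂ hq₂
  let K := J₃.map (algebraMap R L)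
  let ψ : R →+* L ⧸ K := (Ideal.Quotient.mk K).comp (algebraMap R L)
  have hψ : ∀ r, ψ r = 0 ↔ ∃ m, m ∉ 𝔪 ∧ m * r ∈ J₃ := fun r => by
    change Ideal.Quotient.mk K (algebraMap R L r) = 0 ↔ _
    rw [Ideal.Quotient.eq_zero_iff_mem, IsLocalization.algebraMap_mem_map_algebraMap_iff
      𝔪.primeCompl]
    exact Iff.rfl
  have hone : (1 : R) ∉ 𝔪 := (Ideal.ne_top_iff_one 𝔪).mp (Ideal.IsMaximal.ne_top ‹_›)
  have hψJ : ∀ r ∈ J₃, ψ r = 0 := fun r hr => (hψ r).mpr ⟨1, hone, by rwa [one_mul]⟩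
  have hψa : ψ a ≠ 0 := fun h0 => by
    obtain ⟨m, hm, hma⟩ := (hψ a).mp h0
    exact ha0 m hm hma
  let I : Ideal (L ⧸ K) := 𝔪.map ψ
  have hIN : I ^ N = ⊥ := by
    rw [← Ideal.map_pow, eq_bot_iff, Ideal.map_le_iff_le_comap]
    exact fun r hr => hψJ r (hN hr)
  have hIann : ∀ c : R, (∀ t ∈ 𝔪, t * c ∈ J₃) → ∀ t ∈ I, t * ψ c = 0 := by
    intro c hc t ht
    refine Submodule.span_induction (p := fun t _ => t * ψ c = 0) ?_ (zero_mul _)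
      (fun x y _ _ hx hy => by rw [add_mul, hx, hy, add_zero])
      (fun r x _ hx => by rw [smul_eq_mul, mul_assoc, hx, mul_zero]) ht
    rintro _ ⟨t, ht, rfl⟩
    rw [← map_mul]
    exact hψJ _ (hc t ht)
  have hImax : I.IsMaximal := by
    have hI : I = (𝔪.map (algebraMap R L)).map (Ideal.Quotient.mk K) :=
      (Ideal.map_map _ _).symm
    have := Ideal.map_eq_top_or_isMaximal_of_surjective (Ideal.Quotient.mk K)
      Ideal.Quotient.mk_surjective (I := 𝔪.map (algebraMap R L)) inferInstance
    rw [← hI] at this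
    refine this.resolve_left fun htop => hψa ?_
    rw [← one_mul (ψ a)]
    exact hIann a ha 1 (htop ▸ Submodule.mem_top)
  obtain ⟨r, hr⟩ := exists_eq_mul_of_hasInjectiveDimensionLE I hψa (hIann a ha) (hIann b hb)
    hIN hq₃
  obtain ⟨z, rfl⟩ := Ideal.Quotient.mk_surjective r
  obtain ⟨⟨r, s⟩, hrs⟩ := IsLocalization.surj 𝔪.primeCompl z
  have h0 : ψ (s * b - r * a) = 0 := by
    have hrs' : Ideal.Quotient.mk K z * ψ s = ψ r := by
      change _ * Ideal.Quotient.mk K _ = Ideal.Quotient.mk K _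
      rw [← map_mul, hrs]
    rw [map_sub, map_mul, map_mul, hr, ← hrs']
    ring
  obtain ⟨m, hm, hmr⟩ := (hψ _).mp h0
  refine ⟨m * s, 𝔪.primeCompl.mul_mem hm s.2, m * r, ?_⟩
  rwa [mul_sub, ← mul_assoc, ← mul_assoc] at hmr

/-- The subalgebra of polynomials all of whose monomials have exponent in `Λ`. -/
def monomialSubalgebra (F : Type u) [Field F] {n : ℕ} (Λ : AddSubmonoid (Fin n →₀ ℕ)) :
    Subalgebra F (MvPolynomial (Fin n) F) where
  carrier := {P | ∀ e, coeff e P ≠ 0 → e ∈ Λ}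
  mul_mem' := by
    intro P Q hP hQ e he
    rw [coeff_mul] at he
    obtain ⟨x, hx, hne⟩ := Finset.exists_ne_zero_of_sum_ne_zero he
    rw [← Finset.HasAntidiagonal.mem_antidiagonal.mp hx]
    exact Λ.add_mem (hP _ (left_ne_zero_of_mul hne)) (hQ _ (right_ne_zero_of_mul hne))
  add_mem' := by
    intro P Q hP hQ e he
    rw [coeff_add] at he
    by_cases h : coeff e P = 0
    · exact hQ e (by simpa [h] using he)
    · exact hP e h
  algebraMap_mem' := by
    intro r e he
    rw [algebraMap_eq, coeff_C] at he
    split_ifs at he with h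
    · exact h ▸ Λ.zero_mem
    · exact absurd rfl he

lemma mem_monomialSubalgebra {F : Type u} [Field F] {n : ℕ} {Λ : AddSubmonoid (Fin n →₀ ℕ)}
    {P : MvPolynomial (Fin n) F} :
    P ∈ monomialSubalgebra F Λ ↔ ∀ e, coeff e P ≠ 0 → e ∈ Λ := Iff.rfl

lemma monomial_mem_monomialSubalgebra {F : Type u} [Field F] {n : ℕ}
    {Λ : AddSubmonoid (Fin n →₀ ℕ)} {e : Fin n →₀ ℕ} (he : e ∈ Λ) (c : F) :
    monomial e c ∈ monomialSubalgebra F Λ := by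
  intro e' h
  rw [coeff_monomial] at h
  split_ifs at h with h'
  · exact h' ▸ he
  · exact absurd rfl h

lemma smul_mem_of_forall_single_mem {n m : ℕ} {Λ : AddSubmonoid (Fin n →₀ ℕ)}
    (hm : ∀ i, Finsupp.single i m ∈ Λ) (e : Fin n →₀ ℕ) : m • e ∈ Λ := by
  induction e using Finsupp.induction_linear with
  | zero => simp
  | add e f he hf => rw [smul_add]; exact Λ.add_mem he hf
  | single i k =>
    have : m • Finsupp.single i k = k • Finsupp.single i m := by
      simp [mul_comm]
    rw [this]
    exact Λ.nsmul_mem (hm i) k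

lemma smul_div_add_mod {n : ℕ} (m : ℕ) (u : Fin n →₀ ℕ) :
    m • u.mapRange (· / m) (Nat.zero_div m) + u.mapRange (· % m) (Nat.zero_mod m) = u := by
  ext i
  simp [Nat.div_add_mod]

lemma mod_mem_of_forall_single_mem {n m : ℕ} {Λ : AddSubmonoid (Fin n →₀ ℕ)}
    (hsub : ∀ e f, e ∈ Λ → e + f ∈ Λ → f ∈ Λ)
    (hm : ∀ i, Finsupp.single i m ∈ Λ) {u : Fin n →₀ ℕ} (hu : u ∈ Λ) :
    u.mapRange (· % m) (Nat.zero_mod m) ∈ Λ :=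
  hsub _ _ (smul_mem_of_forall_single_mem hm _) ((smul_div_add_mod m u).symm ▸ hu)

/-- The map `X i ↦ X i ^ m` into a monomial subalgebra. -/
def expandTo {F : Type u} [Field F] {n m : ℕ} {Λ : AddSubmonoid (Fin n →₀ ℕ)}
    (hm : ∀ i, Finsupp.single i m ∈ Λ) :
    MvPolynomial (Fin n) F →ₐ[F] monomialSubalgebra F Λ :=
  (expand m).codRestrict _ fun P => by
    induction P using MvPolynomial.induction_on' with
    | monomial e c =>
      rw [expand_monomial]
      exact monomial_mem_monomialSubalgebra (smul_mem_of_forall_single_mem hm e) c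
    | add P Q hP hQ => rw [map_add]; exact add_mem hP hQ

/-- Multiplication by the monomials with exponents `< m` makes a monomial subalgebra free. -/
lemma exists_basis_expandTo {F : Type u} [Field F] {n m : ℕ} (hm0 : 0 < m)
    {Λ : AddSubmonoid (Fin n →₀ ℕ)} (hsub : ∀ e f, e ∈ Λ → e + f ∈ Λ → f ∈ Λ)
    (hm : ∀ i, Finsupp.single i m ∈ Λ) :
    let _ := (expandTo (F := F) hm).toRingHom.toAlgebra
    ∃ b : Module.Basis {r : Fin n →₀ ℕ // r ∈ Λ ∧ ∀ i, r i < m} (MvPolynomial (Fin n) F)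
      (monomialSubalgebra F Λ), ∀ r, (b r : MvPolynomial (Fin n) F) = monomial r.1 1 := by
  let _ := (expandTo (F := F) hm).toRingHom.toAlgebra
  let v : {r : Fin n →₀ ℕ // r ∈ Λ ∧ ∀ i, r i < m} → monomialSubalgebra F Λ := fun r =>
    ⟨monomial r.1 1, monomial_mem_monomialSubalgebra r.2.1 1⟩
  have hsmul : ∀ (a : MvPolynomial (Fin n) F) (x : monomialSubalgebra F Λ),
      ((a • x : monomialSubalgebra F Λ) : MvPolynomial (Fin n) F) = expand m a * x :=
    fun a x => rfl
  have hv : LinearIndependent (MvPolynomial (Fin n) F) v := by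
    rw [linearIndependent_iff']
    intro s g hg r hr
    ext e
    have h := congrArg (fun x : monomialSubalgebra F Λ =>
      coeff (m • e + r.1) (x : MvPolynomial (Fin n) F)) hg
    simp only [AddSubmonoidClass.coe_finsetSum, coeff_sum, hsmul, ZeroMemClass.coe_zero,
      coeff_zero] at h
    rw [Finset.sum_eq_single r] at h
    · rw [coeff_mul_monomial, mul_one, coeff_expand_smul _ hm0.ne'] at h
      simpa using h
    · intro t _ htr
      rw [coeff_mul_monomial']
      split_ifs with hle
      · obtain ⟨i, hi⟩ : ∃ i, t.1 i ≠ r.1 i := by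
          by_contra! hcon
          exact htr (Subtype.ext (Finsupp.ext hcon))
        rw [coeff_expand_of_not_dvd (i := i), zero_mul]
        rintro ⟨k, hk⟩
        have hle := hle i
        simp only [Finsupp.tsub_apply, Finsupp.add_apply, Finsupp.smul_apply, smul_eq_mul] at hk hle
        have h1 : m * e i + r.1 i = m * k + t.1 i := by omega
        have h2 := congrArg (· % m) h1
        simp only [Nat.mul_add_mod, Nat.mod_eq_of_lt (r.2.2 i), Nat.mod_eq_of_lt (t.2.2 i)] at h2
        exact hi h2.symm
      · rfl
    · exact fun h => absurd hr h
  have hspan : ⊤ ≤ Submodule.span (MvPolynomial (Fin n) F) (Set.range v) := by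
    rintro ⟨P, hP⟩ -
    have hmon : ∀ e : Fin n →₀ ℕ, ∀ c : F, ∀ he : e ∈ Λ,
        (⟨monomial e c, monomial_mem_monomialSubalgebra he c⟩ : monomialSubalgebra F Λ) ∈
          Submodule.span (MvPolynomial (Fin n) F) (Set.range v) := by
      intro e c he
      have : (⟨monomial e c, monomial_mem_monomialSubalgebra he c⟩ : monomialSubalgebra F Λ) =
          monomial (e.mapRange (· / m) (Nat.zero_div m)) c •
            v ⟨e.mapRange (· % m) (Nat.zero_mod m), mod_mem_of_forall_single_mem hsub hm he,
              fun i => by simpa using Nat.mod_lt _ hm0⟩ := by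
        apply Subtype.ext
        rw [hsmul, expand_monomial, monomial_mul, smul_div_add_mod, mul_one]
      rw [this]
      exact Submodule.smul_mem _ _ (Submodule.subset_span ⟨_, rfl⟩)
    have : (⟨P, hP⟩ : monomialSubalgebra F Λ) = ∑ e ∈ P.support.attach,
        ⟨monomial e.1 (coeff e.1 P), monomial_mem_monomialSubalgebra
          (hP e.1 (mem_support_iff.mp e.2)) _⟩ := by
      apply Subtype.ext
      rw [AddSubmonoidClass.coe_finsetSum]
      rw [Finset.sum_attach P.support fun e => monomial e (coeff e P)]
      exact P.as_sum
    rw [this]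
    exact Submodule.sum_mem _ fun e _ => hmon _ _ (hP e.1 (mem_support_iff.mp e.2))
  exact ⟨Module.Basis.mk hv hspan, fun r => by rw [Module.Basis.mk_apply]⟩

lemma finite_box {n m : ℕ} (Λ : AddSubmonoid (Fin n →₀ ℕ)) :
    Finite {r : Fin n →₀ ℕ // r ∈ Λ ∧ ∀ i, r i < m} := by
  refine Finite.of_injective
    (fun r => (fun i => ⟨r.1 i, r.2.2 i⟩ : Fin n → Fin m)) fun r s h => ?_
  refine Subtype.ext (Finsupp.ext fun i => ?_)
  simpa using congrFun h i

lemma isNoetherianRing_monomialSubalgebra {F : Type u} [Field F] {n m : ℕ} (hm0 : 0 < m)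
    {Λ : AddSubmonoid (Fin n →₀ ℕ)} (hsub : ∀ e f, e ∈ Λ → e + f ∈ Λ → f ∈ Λ)
    (hm : ∀ i, Finsupp.single i m ∈ Λ) : IsNoetherianRing (monomialSubalgebra F Λ) := by
  let _ := (expandTo (F := F) hm).toRingHom.toAlgebra
  obtain ⟨b, -⟩ := exists_basis_expandTo (F := F) hm0 hsub hm
  have := finite_box (m := m) Λ
  have : Module.Finite (MvPolynomial (Fin n) F) (monomialSubalgebra F Λ) :=
    Module.Finite.of_basis b
  exact IsNoetherianRing.of_finite (MvPolynomial (Fin n) F) _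

lemma isGorensteinRing_monomialSubalgebra {F : Type u} [Field F] {n m : ℕ} (hm0 : 0 < m)
    {Λ : AddSubmonoid (Fin n →₀ ℕ)} (hsub : ∀ e f, e ∈ Λ → e + f ∈ Λ → f ∈ Λ)
    (hm : ∀ i, Finsupp.single i m ∈ Λ)
    (htop : Finsupp.equivFunOnFinite.symm (fun _ => m - 1) ∈ Λ) :
    IsGorensteinRing (monomialSubalgebra F Λ) := by
  have hN := isNoetherianRing_monomialSubalgebra (F := F) hm0 hsub hm
  let _ := (expandTo (F := F) hm).toRingHom.toAlgebra
  obtain ⟨b, hb⟩ := exists_basis_expandTo (F := F) hm0 hsub hm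
  have := finite_box (m := m) Λ
  have := Fintype.ofFinite {r : Fin n →₀ ℕ // r ∈ Λ ∧ ∀ i, r i < m}
  have : Module.Projective (MvPolynomial (Fin n) F) (monomialSubalgebra F Λ) :=
    Module.Projective.of_basis b
  set top : Fin n →₀ ℕ := Finsupp.equivFunOnFinite.symm (fun _ => m - 1) with htopdef
  have htop' : ∀ i, top i = m - 1 := fun i => rfl
  let T : {r : Fin n →₀ ℕ // r ∈ Λ ∧ ∀ i, r i < m} := ⟨top, htop, fun i => by rw [htop']; omega⟩
  have hadd : ∀ r : {r : Fin n →₀ ℕ // r ∈ Λ ∧ ∀ i, r i < m}, r.1 + (top - r.1) = top := by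
    intro r
    ext i
    have := r.2.2 i
    simp only [Finsupp.add_apply, Finsupp.tsub_apply, htop']
    omega
  let star : {r : Fin n →₀ ℕ // r ∈ Λ ∧ ∀ i, r i < m} →
      {r : Fin n →₀ ℕ // r ∈ Λ ∧ ∀ i, r i < m} := fun r =>
    ⟨top - r.1, hsub r.1 _ r.2.1 ((hadd r).symm ▸ htop), fun i => by
      simp only [Finsupp.tsub_apply, htop']; omega⟩
  have hsmul : ∀ (a : MvPolynomial (Fin n) F) (x : monomialSubalgebra F Λ),
      ((a • x : monomialSubalgebra F Λ) : MvPolynomial (Fin n) F) = expand m a * x :=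
    fun a x => rfl
  have key : ∀ s t, b.coord T (b s * b t) = if s = star t then 1 else 0 := by
    intro s t
    let e := s.1 + t.1
    have he : e ∈ Λ := Λ.add_mem s.2.1 t.2.1
    let q : {r : Fin n →₀ ℕ // r ∈ Λ ∧ ∀ i, r i < m} :=
      ⟨e.mapRange (· % m) (Nat.zero_mod m), mod_mem_of_forall_single_mem hsub hm he,
        fun i => by simpa using Nat.mod_lt _ hm0⟩
    have hprod : b s * b t =
        monomial (e.mapRange (· / m) (Nat.zero_div m)) (1 : F) • b q := by
      apply Subtype.ext
      rw [hsmul, hb, expand_monomial, monomial_mul, smul_div_add_mod, mul_one]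
      change (b s : MvPolynomial (Fin n) F) * (b t : MvPolynomial (Fin n) F) = _
      rw [hb, hb, monomial_mul, mul_one]
    rw [hprod, map_smul, Module.Basis.coord_apply, Module.Basis.repr_self]
    split_ifs with hst
    · have hee : e = top := by
        change s.1 + t.1 = top
        rw [hst, add_comm]
        exact hadd t
      have hq : q = T := by
        refine Subtype.ext (Finsupp.ext fun i => ?_)
        change e i % m = top i
        rw [hee, htop', Nat.mod_eq_of_lt (by omega)]
      have hd : e.mapRange (· / m) (Nat.zero_div m) = 0 := by
        ext i
        change e i / m = 0
        rw [hee, htop', Nat.div_eq_of_lt (by omega)]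
      rw [hq, Finsupp.single_eq_same, hd]
      simp
    · rw [Finsupp.single_eq_of_ne, smul_zero]
      rintro hq
      apply hst
      refine Subtype.ext (Finsupp.ext fun i => ?_)
      have h1 : (s.1 i + t.1 i) % m = m - 1 :=
        (DFunLike.congr_fun (congrArg Subtype.val hq) i).symm
      have hs := s.2.2 i
      have ht := t.2.2 i
      change s.1 i = (m - 1) - t.1 i
      rcases lt_or_ge (s.1 i + t.1 i) m with h | h
      · rw [Nat.mod_eq_of_lt h] at h1; omega
      · rw [Nat.mod_eq_sub_mod h, Nat.mod_eq_of_lt (by omega)] at h1; omega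
  refine isGorensteinRing_of_frobenius n (forall_hasInjectiveDimensionLE_mvPolynomial F n _)
    (b.coord T) ?_ ?_
  · intro r hr
    apply b.ext_elem
    intro t
    have h := hr (b (star t))
    rw [← b.sum_repr r, Finset.mul_sum, map_sum] at h
    simp only [mul_smul_comm, map_smul, key] at h
    have hst : ∀ x, star t = star x ↔ x = t := by
      intro x
      constructor
      · intro hx
        refine Subtype.ext (add_right_cancel (b := top - t.1) ?_)
        have hx' : top - t.1 = top - x.1 := congrArg Subtype.val hx
        rw [hadd t, hx', hadd x]
      · rintro rfl; rfl
    simpa [hst] using h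
  · intro ψ
    refine ⟨∑ t, ψ (b t) • b (star t), fun s => ?_⟩
    have hss : ∀ x, star (star x) = x := by
      intro x
      refine Subtype.ext (Finsupp.ext fun i => ?_)
      change m - 1 - (m - 1 - x.1 i) = x.1 i
      have := x.2.2 i
      omega
    have : ψ = (b.coord T).comp
        ((LinearMap.mul (MvPolynomial (Fin n) F) (monomialSubalgebra F Λ)).flip
          (∑ t, ψ (b t) • b (star t))) := by
      refine b.ext fun s => ?_
      change ψ (b s) = b.coord T (b s * ∑ t, ψ (b t) • b (star t))
      simp only [Finset.mul_sum, mul_smul_comm, map_sum, map_smul, key, hss]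
      simp
    exact DFunLike.congr_fun this s

/-- The ideal of elements of a monomial subalgebra, each of whose monomials is divisible by some
`X i ^ m` with `i < k`. -/
def boxIdeal (F : Type u) [Field F] (Λ : AddSubmonoid (Fin 3 →₀ ℕ)) (m k : ℕ) :
    Ideal (monomialSubalgebra F Λ) where
  carrier := {P | ∀ e, coeff e (P : MvPolynomial (Fin 3) F) ≠ 0 →
    ∃ i : Fin 3, i.1 < k ∧ m ≤ e i}
  add_mem' := by
    intro P Q hP hQ e he
    rw [Subalgebra.coe_add, coeff_add] at he
    by_cases h : coeff e (P : MvPolynomial (Fin 3) F) = 0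
    · exact hQ e (by simpa [h] using he)
    · exact hP e h
  zero_mem' := fun e he => absurd (coeff_zero e) he
  smul_mem' := by
    intro P Q hQ e he
    rw [smul_eq_mul, Subalgebra.coe_mul, coeff_mul] at he
    obtain ⟨x, hx, hne⟩ := Finset.exists_ne_zero_of_sum_ne_zero he
    rw [← Finset.HasAntidiagonal.mem_antidiagonal.mp hx]
    obtain ⟨i, hi, hle⟩ := hQ _ (right_ne_zero_of_mul hne)
    exact ⟨i, hi, hle.trans (by simp)⟩

lemma boxIdeal_zero {F : Type u} [Field F] {Λ : AddSubmonoid (Fin 3 →₀ ℕ)} {m : ℕ} :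
    boxIdeal F Λ m 0 = ⊥ := by
  refine le_bot_iff.mp fun P hP => (Submodule.mem_bot _).mpr (Subtype.ext (MvPolynomial.ext _ _ ?_))
  intro e
  by_contra h
  obtain ⟨i, hi, -⟩ := hP e h
  exact absurd hi (Nat.not_lt_zero _)

/-- The element `X i ^ m` of a monomial subalgebra. -/
def powVar (F : Type u) [Field F] {Λ : AddSubmonoid (Fin 3 →₀ ℕ)} {m : ℕ}
    (hm : ∀ i, Finsupp.single i m ∈ Λ) (i : Fin 3) : monomialSubalgebra F Λ :=
  ⟨monomial (Finsupp.single i m) 1, monomial_mem_monomialSubalgebra (hm i) 1⟩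

lemma boxIdeal_succ {F : Type u} [Field F] {m : ℕ} {Λ : AddSubmonoid (Fin 3 →₀ ℕ)}
    (hsub : ∀ e f, e ∈ Λ → e + f ∈ Λ → f ∈ Λ) (hm : ∀ i, Finsupp.single i m ∈ Λ) (k : Fin 3) :
    boxIdeal F Λ m (k + 1) = boxIdeal F Λ m k ⊔ Ideal.span {powVar F hm k} := by
  apply le_antisymm
  · intro P hP
    let s : Fin 3 →₀ ℕ := Finsupp.single k m
    have hQ : (P : MvPolynomial (Fin 3) F).divMonomial s ∈ monomialSubalgebra F Λ := by
      intro e he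
      rw [coeff_divMonomial] at he
      exact hsub _ _ (hm k) (P.2 _ he)
    have hP' : (P : MvPolynomial (Fin 3) F).modMonomial s ∈ monomialSubalgebra F Λ := by
      intro e he
      by_cases hle : s ≤ e
      · exact absurd (coeff_modMonomial_of_le _ hle) he
      · exact P.2 _ (by rwa [coeff_modMonomial_of_not_le _ hle] at he)
    have heq : P = ⟨_, hP'⟩ + ⟨_, hQ⟩ * powVar F hm k := by
      apply Subtype.ext
      change (P : MvPolynomial (Fin 3) F) = _ + _ * monomial s 1
      rw [mul_comm, add_comm]
      exact (divMonomial_add_modMonomial _ s).symm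
    rw [heq]
    refine Submodule.add_mem_sup ?_ (Ideal.mul_mem_left _ _ (Ideal.subset_span rfl))
    intro e he
    by_cases hle : s ≤ e
    · exact absurd (coeff_modMonomial_of_le _ hle) he
    · change coeff e ((P : MvPolynomial (Fin 3) F).modMonomial s) ≠ 0 at he
      rw [coeff_modMonomial_of_not_le _ hle] at he
      obtain ⟨i, hi, hi'⟩ := hP e he
      refine ⟨i, lt_of_le_of_ne (Nat.lt_succ_iff.mp hi) ?_, hi'⟩
      intro hik
      exact hle (Finsupp.single_le_iff.mpr (Fin.ext hik ▸ hi'))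
  · refine sup_le (fun P hP e he => ?_) ?_
    · obtain ⟨i, hi, hi'⟩ := hP e he
      exact ⟨i, Nat.lt_succ_of_lt hi, hi'⟩
    · rw [Ideal.span_singleton_le_iff_mem]
      intro e he
      change coeff e (monomial (Finsupp.single k m) (1 : F)) ≠ 0 at he
      rw [coeff_monomial] at he
      split_ifs at he with h
      · exact ⟨k, Nat.lt_succ_self _, by rw [← h]; simp⟩
      · exact absurd rfl he

lemma mem_boxIdeal_of_powVar_mul_mem {F : Type u} [Field F] {m : ℕ}
    {Λ : AddSubmonoid (Fin 3 →₀ ℕ)} (hm : ∀ i, Finsupp.single i m ∈ Λ) (k : Fin 3)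
    (r : monomialSubalgebra F Λ) (hr : powVar F hm k * r ∈ boxIdeal F Λ m k) :
    r ∈ boxIdeal F Λ m k := by
  intro e he
  obtain ⟨i, hi, hi'⟩ := hr (Finsupp.single k m + e) (by
    change coeff _ (monomial (Finsupp.single k m) (1 : F) * (r : MvPolynomial (Fin 3) F)) ≠ 0
    rwa [coeff_monomial_mul, one_mul])
  refine ⟨i, hi, ?_⟩
  have hne : k ≠ i := by rintro rfl; exact lt_irrefl _ hi
  simpa [Finsupp.single_apply, hne] using hi'

lemma le_degree_of_mem_ker_pow {F : Type u} [Field F] {Λ : AddSubmonoid (Fin 3 →₀ ℕ)} {N : ℕ}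
    {P : monomialSubalgebra F Λ}
    (hP : P ∈ (RingHom.ker ((constantCoeff (R := F) (σ := Fin 3)).comp
      (monomialSubalgebra F Λ).subtype)) ^ N) (e : Fin 3 →₀ ℕ)
    (he : coeff e (P : MvPolynomial (Fin 3) F) ≠ 0) : N ≤ e 0 + e 1 + e 2 := by
  induction N generalizing P e with
  | zero => exact Nat.zero_le _
  | succ N ih =>
    rw [pow_succ] at hP
    induction hP using Submodule.mul_induction_on' generalizing e with
    | mem_mul_mem Q hQ S hS =>
      rw [Subalgebra.coe_mul, coeff_mul] at he
      obtain ⟨x, hx, hne⟩ := Finset.exists_ne_zero_of_sum_ne_zero he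
      rw [← Finset.HasAntidiagonal.mem_antidiagonal.mp hx]
      have h1 := ih hQ _ (left_ne_zero_of_mul hne)
      have h2 : x.2 ≠ 0 := by
        intro h0
        apply right_ne_zero_of_mul hne
        rw [h0]
        exact hS
      have h3 : x.2 0 + x.2 1 + x.2 2 ≠ 0 := by
        intro h
        apply h2
        ext i
        fin_cases i <;> simp <;> omega
      simp only [Finsupp.add_apply]
      omega
    | add Q hQ S hS h1 h2 =>
      rw [Subalgebra.coe_add, coeff_add] at he
      by_cases h : coeff e (Q : MvPolynomial (Fin 3) F) = 0
      · exact h2 e (by simpa [h] using he)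
      · exact h1 e h

lemma top_mem_of_isGorensteinRing {F : Type u} [Field F] {m : ℕ} (hm0 : 0 < m)
    {Λ : AddSubmonoid (Fin 3 →₀ ℕ)} (hsub : ∀ e f, e ∈ Λ → e + f ∈ Λ → f ∈ Λ)
    (hm : ∀ i, Finsupp.single i m ∈ Λ) (hR : IsGorensteinRing (monomialSubalgebra F Λ))
    (hface : ∀ i, ∃ e ∈ Λ, (∀ j, e j < m) ∧ e i = m - 1) :
    Finsupp.equivFunOnFinite.symm (fun _ => m - 1) ∈ Λ := by
  set ε : monomialSubalgebra F Λ →+* F :=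
    (constantCoeff (R := F) (σ := Fin 3)).comp (monomialSubalgebra F Λ).subtype with hε
  have hsurj : Function.Surjective ε := fun c => ⟨algebraMap F _ c, constantCoeff_C _ c⟩
  have hmax : (RingHom.ker ε).IsMaximal := RingHom.ker_isMaximal_of_surjective ε hsurj
  let B : Set (Fin 3 →₀ ℕ) := {e | e ∈ Λ ∧ ∀ i, e i < m}
  have hB : B.Finite := finite_box (m := m) Λ
  let mon : ∀ u : B, monomialSubalgebra F Λ := fun u =>
    ⟨monomial u.1 1, monomial_mem_monomialSubalgebra u.2.1 1⟩
  have hcoe : ∀ (t : monomialSubalgebra F Λ) (u : B),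
      ((t * mon u : monomialSubalgebra F Λ) : MvPolynomial (Fin 3) F) =
        (t : MvPolynomial (Fin 3) F) * monomial u.1 1 :=
    fun t u => rfl
  have hnot : ∀ (P : monomialSubalgebra F Λ) (u : B),
      coeff u.1 (P : MvPolynomial (Fin 3) F) ≠ 0 → P ∉ boxIdeal F Λ m 3 := by
    intro P u hu hP
    obtain ⟨i, -, hi⟩ := hP _ hu
    exact absurd (u.2.2 i) (not_lt.mpr hi)
  have hself : ∀ (t : monomialSubalgebra F Λ) (u : B),
      coeff u.1 ((t * mon u : monomialSubalgebra F Λ) : MvPolynomial (Fin 3) F) = ε t := by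
    intro t u
    have := coeff_mul_monomial 0 u.1 (1 : F) (t : MvPolynomial (Fin 3) F)
    rw [zero_add, mul_one] at this
    exact this
  have hsocle : ∀ u : B, Maximal (· ∈ B) u.1 → ∀ t ∈ RingHom.ker ε,
      t * mon u ∈ boxIdeal F Λ m 3 := by
    intro u hu t ht e he
    rw [hcoe, coeff_mul_monomial'] at he
    split_ifs at he with hle
    · by_contra! hcon
      have heB : e ∈ B := by
        refine ⟨?_, fun i => hcon i i.2⟩
        rw [← tsub_add_cancel_of_le hle]
        exact Λ.add_mem (t.2 _ (left_ne_zero_of_mul he)) u.2.1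
      have : e = u.1 := le_antisymm (hu.2 heB hle) hle
      rw [this, tsub_self] at he
      exact left_ne_zero_of_mul he ht
    · exact absurd rfl he
  have hpow : (RingHom.ker ε) ^ (3 * m) ≤ boxIdeal F Λ m 3 := by
    intro P hP e he
    have := le_degree_of_mem_ker_pow hP e he
    by_contra! hcon
    have h0 := hcon 0 (by decide)
    have h1 := hcon 1 (by decide)
    have h2 := hcon 2 (by decide)
    omega
  have huniq : ∀ u u' : B, Maximal (· ∈ B) u.1 → Maximal (· ∈ B) u'.1 → u = u' := by
    intro u u' hu hu'
    obtain ⟨t, ht, r, hr⟩ := hR.exists_mul_sub_mem (RingHom.ker ε)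
      (x₀ := powVar F hm 0) (x₁ := powVar F hm 1) (x₂ := powVar F hm 2)
      (J₁ := boxIdeal F Λ m 1) (J₂ := boxIdeal F Λ m 2) (J₃ := boxIdeal F Λ m 3)
      (by rw [← boxIdeal_zero (m := m)]; exact boxIdeal_succ hsub hm 0)
      (boxIdeal_succ hsub hm 1) (boxIdeal_succ hsub hm 2)
      (fun r hr => by
        have := mem_boxIdeal_of_powVar_mul_mem hm 0 r (by rw [hr]; exact zero_mem _)
        rw [show ((0 : Fin 3) : ℕ) = 0 from rfl, boxIdeal_zero] at this
        exact this)
      (mem_boxIdeal_of_powVar_mul_mem hm 1) (mem_boxIdeal_of_powVar_mul_mem hm 2) hpow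
      (a := mon u) (b := mon u') (fun t ht => hnot _ u (by rwa [hself]))
      (hsocle u hu) (hsocle u' hu')
    by_contra hne
    refine hnot _ u' ?_ hr
    rw [Subalgebra.coe_sub, coeff_sub, hself, hcoe, coeff_mul_monomial', if_neg, sub_zero]
    · exact ht
    · intro hle
      exact hne (Subtype.ext (le_antisymm hle (hu.2 u'.2 hle)))
  have hex : ∀ i, ∃ u : B, Maximal (· ∈ B) u.1 ∧ u.1 i = m - 1 := by
    intro i
    obtain ⟨e, he, he', hei⟩ := hface i
    obtain ⟨u, hle, hu⟩ := hB.exists_le_maximal (show e ∈ B from ⟨he, he'⟩)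
    refine ⟨⟨u, hu.1⟩, hu, ?_⟩
    have h1 := hle i
    have h2 := hu.1.2 i
    change u i = m - 1
    omega
  obtain ⟨u, hu, -⟩ := hex 0
  have : Finsupp.equivFunOnFinite.symm (fun _ => m - 1) = u.1 := by
    ext i
    obtain ⟨u', hu', hi⟩ := hex i
    rw [huniq u u' hu hu', hi]
    rfl
  rw [this]
  exact u.2.1

/-- The exponents of the monomials fixed by a family of diagonal matrices. -/
def charMonoid {F : Type u} [Field F] {ι : Type*} (χ : ι → Fin 3 → F) :
    AddSubmonoid (Fin 3 →₀ ℕ) where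
  carrier := {e | ∀ g, χ g 0 ^ e 0 * χ g 1 ^ e 1 * χ g 2 ^ e 2 = 1}
  add_mem' := by
    intro e f he hf g
    simp only [Finsupp.add_apply, pow_add]
    calc _ = (χ g 0 ^ e 0 * χ g 1 ^ e 1 * χ g 2 ^ e 2) *
          (χ g 0 ^ f 0 * χ g 1 ^ f 1 * χ g 2 ^ f 2) := by ring
      _ = 1 := by rw [he g, hf g, mul_one]
  zero_mem' := by intro g; simp

lemma isGorensteinRing_charMonoid_iff {F : Type u} [Field F] {ι : Type*} (χ : ι → Fin 3 → F)
    {m : ℕ} (hm0 : 0 < m) (hm : ∀ g i, χ g i ^ m = 1)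
    (hface : ∀ i, ∃ e ∈ charMonoid χ, (∀ j, e j < m) ∧ e i = m - 1) :
    IsGorensteinRing (monomialSubalgebra F (charMonoid χ)) ↔
      ∀ g, χ g 0 * χ g 1 * χ g 2 = 1 := by
  have hsub : ∀ e f, e ∈ charMonoid χ → e + f ∈ charMonoid χ → f ∈ charMonoid χ := by
    intro e f he hef g
    have h := hef g
    simp only [Finsupp.add_apply, pow_add] at h
    calc _ = (χ g 0 ^ e 0 * χ g 1 ^ e 1 * χ g 2 ^ e 2) *
          (χ g 0 ^ f 0 * χ g 1 ^ f 1 * χ g 2 ^ f 2) := by rw [he g, one_mul]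
      _ = 1 := by rw [← h]; ring
  have hm' : ∀ i, Finsupp.single i m ∈ charMonoid χ := by
    intro i g
    fin_cases i <;> simp [hm]
  constructor
  · intro hR g
    have h := top_mem_of_isGorensteinRing hm0 hsub hm' hR hface g
    simp only [Finsupp.equivFunOnFinite_symm_apply_apply] at h
    have h2 : (χ g 0 * χ g 1 * χ g 2) ^ m = 1 := by simp [mul_pow, hm]
    rw [← mul_pow, ← mul_pow] at h
    rwa [← Nat.sub_add_cancel hm0, pow_succ, h, one_mul] at h2
  · intro h
    refine isGorensteinRing_monomialSubalgebra hm0 hsub hm' fun g => ?_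
    simp only [Finsupp.equivFunOnFinite_symm_apply_apply]
    rw [← mul_pow, ← mul_pow, h, one_pow]

/-- For characters `x ^ q`, `y ^ q`, `z` with `x * y * z = 1`. -/
lemma isGorensteinRing_charMonoid_iff_of_mul_eq_one {F : Type u} [Field F] {ι : Type*}
    (x y z : ι → F) {m q : ℕ} (hm0 : 0 < m) (hq : Nat.Coprime q m) (hx : ∀ g, x g ^ m = 1)
    (hy : ∀ g, y g ^ m = 1) (hz : ∀ g, z g ^ m = 1) (hxyz : ∀ g, x g * y g * z g = 1) :
    IsGorensteinRing (monomialSubalgebra F (charMonoid fun g => ![x g ^ q, y g ^ q, z g])) ↔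
      ∀ g, x g ^ q * y g ^ q * z g = 1 := by
  have hx' : ∀ g, (x g ^ q) ^ m = 1 := fun g => by rw [← pow_mul', pow_mul, hx, one_pow]
  have hy' : ∀ g, (y g ^ q) ^ m = 1 := fun g => by rw [← pow_mul', pow_mul, hy, one_pow]
  refine isGorensteinRing_charMonoid_iff _ hm0 (fun g i => ?_) fun i => ?_
  · fin_cases i <;> simp [hx', hy', hz]
  have hlt : ∀ k, k % m < m := fun k => Nat.mod_lt _ hm0
  have hlt' : m - 1 < m := Nat.sub_lt hm0 one_pos
  have hmod : ∀ {t : F} (k : ℕ), t ^ m = 1 → t ^ (k % m) = t ^ k := fun k ht =>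
    (pow_eq_pow_mod k ht).symm
  have hq1 : q ^ (m.totient - 1) * q = q ^ m.totient := by
    rw [← pow_succ, Nat.sub_add_cancel (Nat.totient_pos.mpr hm0)]
  have hq2 : ∀ {t : F}, t ^ m = 1 → (t ^ q) ^ (q ^ (m.totient - 1)) = t := by
    intro t ht
    rw [← pow_mul', hq1, pow_eq_pow_mod _ ht, Nat.ModEq.pow_totient hq, ← pow_eq_pow_mod _ ht,
      pow_one]
  have h01 : Finsupp.equivFunOnFinite.symm ![m - 1, m - 1, q * (m - 1) % m] ∈
      charMonoid fun g => ![x g ^ q, y g ^ q, z g] := by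
    intro g
    change (x g ^ q) ^ (m - 1) * (y g ^ q) ^ (m - 1) * z g ^ (q * (m - 1) % m) = 1
    rw [hmod _ (hz g), pow_mul, ← mul_pow, ← mul_pow, ← mul_pow, ← mul_pow, hxyz, one_pow, one_pow]
  set k := q ^ (m.totient - 1)
  fin_cases i
  · refine ⟨_, h01, fun j => ?_, rfl⟩
    fin_cases j <;> simp [hlt, hlt']
  · refine ⟨_, h01, fun j => ?_, rfl⟩
    fin_cases j <;> simp [hlt, hlt']
  · refine ⟨Finsupp.equivFunOnFinite.symm ![k * (m - 1) % m, k * (m - 1) % m, m - 1],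
      fun g => ?_, fun j => ?_, rfl⟩
    · change (x g ^ q) ^ (k * (m - 1) % m) * (y g ^ q) ^ (k * (m - 1) % m) * z g ^ (m - 1) = 1
      rw [hmod _ (hx' g), hmod _ (hy' g), pow_mul, pow_mul, hq2 (hx g), hq2 (hy g), ← mul_pow,
        ← mul_pow, hxyz, one_pow]
    · fin_cases j <;> simp [hlt, hlt']

lemma polyAct_polyAct {F : Type u} [CommSemiring F] {m : ℕ} (M N : Matrix (Fin m) (Fin m) F)
    (P : MvPolynomial (Fin m) F) : polyAct M (polyAct N P) = polyAct (N * M) P := by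
  have : (polyAct M).comp (polyAct N) = polyAct (N * M) := by
    refine algHom_ext fun i => ?_
    simp only [polyAct, AlgHom.comp_apply, aeval_X, map_sum, map_smul, Matrix.mul_apply,
      Finset.sum_smul, Finset.smul_sum, smul_smul]
    exact Finset.sum_comm
  exact DFunLike.congr_fun this P

lemma polyAct_one {F : Type u} [CommSemiring F] {m : ℕ} (P : MvPolynomial (Fin m) F) :
    polyAct (1 : Matrix (Fin m) (Fin m) F) P = P := by
  have : polyAct (1 : Matrix (Fin m) (Fin m) F) = AlgHom.id F _ := by
    refine algHom_ext fun i => ?_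
    simp [polyAct, Matrix.one_apply]
  rw [this, AlgHom.id_apply]

lemma coeff_aeval_smul_X {F : Type u} [Field F] (χ : Fin 3 → F) (P : MvPolynomial (Fin 3) F)
    (e : Fin 3 →₀ ℕ) : coeff e (aeval (fun i => χ i • (X i : MvPolynomial (Fin 3) F)) P) =
      χ 0 ^ e 0 * χ 1 ^ e 1 * χ 2 ^ e 2 * coeff e P := by
  induction P using MvPolynomial.induction_on' with
  | monomial u c =>
    have : aeval (fun i => χ i • (X i : MvPolynomial (Fin 3) F)) (monomial u c) =
        monomial u (χ 0 ^ u 0 * χ 1 ^ u 1 * χ 2 ^ u 2 * c) := by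
      rw [aeval_monomial, monomial_eq, Finsupp.prod_fintype _ _ (by simp),
        Finsupp.prod_fintype _ _ (by simp), Fin.prod_univ_three, Fin.prod_univ_three]
      simp only [smul_eq_C_mul, mul_pow, C_mul, C_pow, algebraMap_eq]
      ring
    rw [this, coeff_monomial, coeff_monomial]
    split_ifs with h
    · rw [h]
    · rw [mul_zero]
  | add P Q hP hQ => rw [map_add, coeff_add, coeff_add, hP, hQ, mul_add]

/-- If the invariants are polynomials in three algebraically independent semi-invariants, then
the invariant ring is a monomial subalgebra in these. -/
lemma nonempty_ringEquiv_invariantRing {F : Type u} [Field F]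
    (G : Subgroup (Matrix.SpecialLinearGroup (Fin 3) F)) (χ : G → Fin 3 → F)
    (Φ : MvPolynomial (Fin 3) F →ₐ[F] MvPolynomial (Fin 3) F) (hinj : Function.Injective Φ)
    (hsemi : ∀ (g : G) i, polyAct (g : Matrix (Fin 3) (Fin 3) F) (Φ (X i)) = χ g i • Φ (X i))
    (hrange : ∀ P ∈ invariantRing G, P ∈ Φ.range) :
    Nonempty (monomialSubalgebra F (charMonoid χ) ≃+* invariantRing G) := by
  have hcomm : ∀ (g : G) P, polyAct (g : Matrix (Fin 3) (Fin 3) F) (Φ P) =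
      Φ (aeval (fun i => χ g i • (X i : MvPolynomial (Fin 3) F)) P) := by
    intro g P
    have : (polyAct (g : Matrix (Fin 3) (Fin 3) F)).comp Φ =
        Φ.comp (aeval (fun i => χ g i • (X i : MvPolynomial (Fin 3) F))) := by
      refine algHom_ext fun i => ?_
      simp [hsemi]
    exact DFunLike.congr_fun this P
  have hmem : ∀ P, P ∈ monomialSubalgebra F (charMonoid χ) ↔ Φ P ∈ invariantRing G := by
    intro P
    have h1 : Φ P ∈ invariantRing G ↔ ∀ g : G,
        aeval (fun i => χ g i • (X i : MvPolynomial (Fin 3) F)) P = P := by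
      constructor
      · intro h g
        apply hinj
        rw [← hcomm]
        exact h _ ⟨g, g.2, rfl⟩
      · rintro h _ ⟨g, hg, rfl⟩
        exact (hcomm ⟨g, hg⟩ P).trans (by rw [h])
    rw [h1, mem_monomialSubalgebra]
    constructor
    · intro h g
      ext e
      rw [coeff_aeval_smul_X]
      by_cases he : coeff e P = 0
      · rw [he, mul_zero]
      · rw [h e he g, one_mul]
    · intro h e he g
      have := congrArg (coeff e) (h g)
      rw [coeff_aeval_smul_X] at this
      exact (mul_eq_right₀ he).mp this
  have hmap : (monomialSubalgebra F (charMonoid χ)).map Φ = invariantRing G := by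
    ext f
    rw [Subalgebra.mem_map]
    constructor
    · rintro ⟨P, hP, rfl⟩
      exact (hmem P).mp hP
    · intro hf
      obtain ⟨P, rfl⟩ := hrange f hf
      exact ⟨P, (hmem P).mpr hf, rfl⟩
  rw [← hmap]
  exact ⟨((monomialSubalgebra F (charMonoid χ)).equivMapOfInjective Φ hinj).toRingEquiv⟩

lemma totalDegree_aeval_le {F σ τ : Type*} [Field F] (g : σ → MvPolynomial τ F)
    (hg : ∀ i, (g i).totalDegree ≤ 1) (P : MvPolynomial σ F) :
    (aeval g P).totalDegree ≤ P.totalDegree := by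
  rw [aeval_def, eval₂_eq]
  refine totalDegree_finsetSum_le fun e he => ?_
  refine (totalDegree_mul _ _).trans ?_
  rw [algebraMap_eq, totalDegree_C, zero_add]
  refine (totalDegree_finsetProd _ _).trans (le_trans ?_ (le_totalDegree he))
  exact Finset.sum_le_sum fun i _ => (totalDegree_pow _ _).trans
    ((Nat.mul_le_mul_left _ (hg i)).trans_eq (mul_one _))

/-- The substitution `X i ↦ l`. -/
def substVar {F : Type u} [Field F] (i : Fin 3) (l : MvPolynomial (Fin 3) F) :
    MvPolynomial (Fin 3) F →ₐ[F] MvPolynomial (Fin 3) F :=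
  aeval (Function.update X i l)

lemma substVar_X_self {F : Type u} [Field F] (i : Fin 3) (l : MvPolynomial (Fin 3) F) :
    substVar i l (X i) = l := by simp [substVar]

lemma substVar_X_of_ne {F : Type u} [Field F] {i j : Fin 3} (h : j ≠ i)
    (l : MvPolynomial (Fin 3) F) : substVar i l (X j) = X j := by simp [substVar, h]

lemma substVar_substVar_self {F : Type u} [Field F] (i : Fin 3) (l l' f : MvPolynomial (Fin 3) F) :
    substVar i l (substVar i l' f) = substVar i (substVar i l l') f := by
  have : (substVar i l).comp (substVar i l') = substVar i (substVar i l l') := by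
    refine algHom_ext fun j => ?_
    rcases eq_or_ne j i with rfl | h
    · simp [substVar_X_self]
    · simp [substVar_X_of_ne h]
  exact DFunLike.congr_fun this f

lemma substVar_comm {F : Type u} [Field F] {i j : Fin 3} (hij : i ≠ j)
    {l l' : MvPolynomial (Fin 3) F} (hl : substVar j l' l = l) (hl' : substVar i l l' = l')
    (f : MvPolynomial (Fin 3) F) :
    substVar i l (substVar j l' f) = substVar j l' (substVar i l f) := by
  have : (substVar i l).comp (substVar j l') = (substVar j l').comp (substVar i l) := by
    refine algHom_ext fun k => ?_
    rcases eq_or_ne k i with rfl | hi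
    · simp [substVar_X_self, substVar_X_of_ne hij, hl]
    · rcases eq_or_ne k j with rfl | hj
      · simp [substVar_X_self, substVar_X_of_ne hi, hl']
      · simp [substVar_X_of_ne hi, substVar_X_of_ne hj]
  exact DFunLike.congr_fun this f

lemma sub_dvd_sub_substVar {F : Type u} [Field F] (i : Fin 3) (l f : MvPolynomial (Fin 3) F) :
    X i - l ∣ f - substVar i l f := by
  rw [← Ideal.mem_span_singleton, ← Ideal.Quotient.eq]
  have : Ideal.Quotient.mkₐ F (Ideal.span {X i - l}) =
      (Ideal.Quotient.mkₐ F (Ideal.span {X i - l})).comp (substVar i l) := by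
    refine algHom_ext fun j => ?_
    rcases eq_or_ne j i with rfl | h
    · rw [AlgHom.comp_apply, substVar_X_self]
      exact Ideal.Quotient.eq.mpr (Ideal.mem_span_singleton_self _)
    · rw [AlgHom.comp_apply, substVar_X_of_ne h]
  exact DFunLike.congr_fun this f

/-- The product of the translates of `X i` by `A • X 2`. -/
def orbitProd {F : Type u} [Field F] (A : AddSubgroup F) [Fintype A] (i : Fin 3) :
    MvPolynomial (Fin 3) F :=
  ∏ x : A, (X i + C (x : F) * X 2)

lemma substVar_orbitProd_self {F : Type u} [Field F] (A : AddSubgroup F) [Fintype A] {i : Fin 3}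
    (hi : i ≠ 2) {x : F} (hx : x ∈ A) :
    substVar i (X i + C x * X 2) (orbitProd A i) = orbitProd A i := by
  rw [orbitProd, map_prod]
  refine Fintype.prod_equiv (Equiv.addRight (⟨x, hx⟩ : A)) _ _ fun y => ?_
  simp only [map_add, map_mul, substVar_X_self, substVar_X_of_ne hi.symm, Equiv.coe_addRight,
    AddSubgroup.coe_add]
  rw [← algebraMap_eq, AlgHom.commutes]
  ring

lemma substVar_orbitProd_of_ne {F : Type u} [Field F] (A : AddSubgroup F) [Fintype A]
    {i j : Fin 3} (hij : i ≠ j) (hj : j ≠ 2) (l : MvPolynomial (Fin 3) F) :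
    substVar j l (orbitProd A i) = orbitProd A i := by
  rw [orbitProd, map_prod]
  refine Finset.prod_congr rfl fun y _ => ?_
  simp only [map_add, map_mul, substVar_X_of_ne hij, substVar_X_of_ne hj.symm]
  rw [← algebraMap_eq, AlgHom.commutes]

lemma isHomogeneous_orbitProd {F : Type u} [Field F] (A : AddSubgroup F) [Fintype A] (i : Fin 3) :
    (orbitProd A i).IsHomogeneous (Fintype.card A) := by
  have := IsHomogeneous.prod Finset.univ (fun x : A => (X i + C (x : F) * X 2)) (fun _ => 1)
    fun x _ => (isHomogeneous_X _ _).add (isHomogeneous_C_mul_X _ _)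
  simpa [orbitProd] using this

lemma substVar_two_orbitProd {F : Type u} [Field F] (A : AddSubgroup F) [Fintype A] {i : Fin 3}
    (hi : i ≠ 2) : substVar 2 0 (orbitProd A i) = X i ^ Fintype.card A := by
  simp [orbitProd, substVar_X_self, substVar_X_of_ne hi]

lemma orbitProd_ne_zero {F : Type u} [Field F] (A : AddSubgroup F) [Fintype A] {i : Fin 3}
    (hi : i ≠ 2) : orbitProd A i ≠ 0 := by
  intro h
  have := substVar_two_orbitProd A hi
  rw [h, map_zero] at this
  exact pow_ne_zero _ (X_ne_zero i) this.symm

lemma orbitProd_dvd_sub {F : Type u} [Field F] (A : AddSubgroup F) [Fintype A] {i : Fin 3}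
    (hi : i ≠ 2) {f : MvPolynomial (Fin 3) F}
    (hf : ∀ x ∈ A, substVar i (X i + C x * X 2) f = f) :
    orbitProd A i ∣ f - substVar i 0 f := by
  have hval : ∀ x ∈ A, substVar i (-(C x * X 2)) (f - substVar i 0 f) = 0 := by
    intro x hx
    rw [map_sub, substVar_substVar_self, map_zero, sub_eq_zero]
    have h1 : substVar i 0 (X i + C (-x) * X 2) = -(C x * X 2) := by
      rw [map_add, map_mul, substVar_X_self, substVar_X_of_ne hi.symm, ← algebraMap_eq,
        AlgHom.commutes]
      simp
    conv_rhs => rw [← hf (-x) (A.neg_mem hx), substVar_substVar_self, h1]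
  suffices h : ∀ s : Finset A, ∏ x ∈ s, (X i + C (x : F) * X 2) ∣ f - substVar i 0 f from
    h Finset.univ
  classical
  intro s
  induction s using Finset.induction_on with
  | empty => simp
  | insert x s hxs ih =>
    obtain ⟨Q, hQ⟩ := ih
    have h0 := hval x x.2
    rw [hQ, map_mul, mul_eq_zero, map_prod, Finset.prod_eq_zero_iff] at h0
    rcases h0 with ⟨y, hy, h0⟩ | h0
    · exfalso
      rw [map_add, map_mul, substVar_X_self, substVar_X_of_ne hi.symm, ← algebraMap_eq,
        AlgHom.commutes, algebraMap_eq, neg_add_eq_sub, ← sub_mul, ← C_sub, mul_eq_zero,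
        or_iff_left (X_ne_zero _), C_eq_zero, sub_eq_zero] at h0
      exact hxs (Subtype.ext h0 ▸ hy)
    · have := sub_dvd_sub_substVar i (-(C (x : F) * X 2)) Q
      rw [h0, sub_zero, sub_neg_eq_add] at this
      rw [Finset.prod_insert hxs, mul_comm, hQ]
      exact mul_dvd_mul_left _ this

lemma totalDegree_substVar_zero_le {F : Type u} [Field F] (i : Fin 3) (f : MvPolynomial (Fin 3) F) :
    (substVar i 0 f).totalDegree ≤ f.totalDegree := by
  refine totalDegree_aeval_le _ (fun j => ?_) f
  rcases eq_or_ne j i with rfl | h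
  · simp
  · simp [h]

lemma substVar_zero_substVar_zero_mem {F : Type u} [Field F] (f : MvPolynomial (Fin 3) F) :
    substVar 1 0 (substVar 0 0 f) ∈ Algebra.adjoin F {(X 2 : MvPolynomial (Fin 3) F)} := by
  have h : ((substVar 1 0).comp (substVar 0 0) :
      MvPolynomial (Fin 3) F →ₐ[F] MvPolynomial (Fin 3) F).range ≤ Algebra.adjoin F {X 2} := by
    rw [← Algebra.map_top, ← adjoin_range_X, AlgHom.map_adjoin, Algebra.adjoin_le_iff]
    rintro _ ⟨_, ⟨j, rfl⟩, rfl⟩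
    fin_cases j
    · simp [substVar_X_self]
    · simp [substVar_X_self, substVar_X_of_ne (show (1 : Fin 3) ≠ 0 by decide)]
    · simp [substVar_X_of_ne (show (2 : Fin 3) ≠ 0 by decide),
        substVar_X_of_ne (show (2 : Fin 3) ≠ 1 by decide)]
  exact h ⟨f, rfl⟩

/-- One division step for translation invariant polynomials. -/
lemma exists_eq_add_orbitProd_mul {F : Type u} [Field F] (A : AddSubgroup F) [Fintype A]
    {i : Fin 3} (hi : i ≠ 2) {f : MvPolynomial (Fin 3) F}
    (hf : ∀ x ∈ A, substVar i (X i + C x * X 2) f = f) :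
    ∃ Q, f = substVar i 0 f + orbitProd A i * Q ∧
      (∀ x ∈ A, substVar i (X i + C x * X 2) Q = Q) ∧
      (∀ j ≠ i, j ≠ 2 → ∀ x, substVar j (X j + C x * X 2) f = f →
        substVar j (X j + C x * X 2) Q = Q) ∧
      (Q ≠ 0 → Fintype.card A + Q.totalDegree ≤ f.totalDegree) := by
  obtain ⟨Q, hQ⟩ := orbitProd_dvd_sub A hi hf
  refine ⟨Q, by rw [← hQ]; ring, fun x hx => ?_, fun j hji hj x hx => ?_, fun hQ0 => ?_⟩
  · refine mul_left_cancel₀ (orbitProd_ne_zero A hi) ?_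
    conv_lhs => rw [← substVar_orbitProd_self A hi hx]
    rw [← map_mul, ← hQ, map_sub, hf x hx, substVar_substVar_self, map_zero]
  · refine mul_left_cancel₀ (orbitProd_ne_zero A hi) ?_
    conv_lhs => rw [← substVar_orbitProd_of_ne A hji.symm hj (X j + C x * X 2)]
    rw [← map_mul, ← hQ, map_sub, hx, substVar_comm hji _ (map_zero _), hx]
    rw [map_add, map_mul, substVar_X_of_ne hji, substVar_X_of_ne hi.symm, ← algebraMap_eq,
      AlgHom.commutes]
  · rw [← (isHomogeneous_orbitProd A i).totalDegree (orbitProd_ne_zero A hi),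
      ← totalDegree_mul_of_isDomain (orbitProd_ne_zero A hi) hQ0, ← hQ]
    exact (totalDegree_sub _ _).trans (max_le le_rfl (totalDegree_substVar_zero_le i f))

lemma substVar_invariant_substVar_zero {F : Type u} [Field F] {i j : Fin 3} (hji : j ≠ i)
    (hi : i ≠ 2) {x : F} {f : MvPolynomial (Fin 3) F}
    (hf : substVar j (X j + C x * X 2) f = f) :
    substVar j (X j + C x * X 2) (substVar i 0 f) = substVar i 0 f := by
  rw [substVar_comm hji _ (map_zero _), hf]
  rw [map_add, map_mul, substVar_X_of_ne hji, substVar_X_of_ne hi.symm, ← algebraMap_eq,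
      AlgHom.commutes]

lemma mem_adjoin_of_translation_invariant {F : Type u} [Field F] (M N : AddSubgroup F) [Fintype M]
    [Fintype N] {f : MvPolynomial (Fin 3) F}
    (hM : ∀ x ∈ M, substVar 0 (X 0 + C x * X 2) f = f)
    (hN : ∀ x ∈ N, substVar 1 (X 1 + C x * X 2) f = f) :
    f ∈ Algebra.adjoin F {orbitProd M 0, orbitProd N 1, X 2} := by
  have h02 : (0 : Fin 3) ≠ 2 := by decide
  have h12 : (1 : Fin 3) ≠ 2 := by decide
  have h10 : (1 : Fin 3) ≠ 0 := by decide
  induction hd : f.totalDegree using Nat.strong_induction_on generalizing f with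
  | _ d ih =>
    have key : ∀ Q : MvPolynomial (Fin 3) F, (∀ x ∈ M, substVar 0 (X 0 + C x * X 2) Q = Q) →
        (∀ x ∈ N, substVar 1 (X 1 + C x * X 2) Q = Q) → (Q ≠ 0 → Q.totalDegree < d) →
        Q ∈ Algebra.adjoin F {orbitProd M 0, orbitProd N 1, X 2} := by
      intro Q h1 h2 h3
      rcases eq_or_ne Q 0 with rfl | h0
      · exact zero_mem _
      · exact ih _ (h3 h0) h1 h2 rfl
    obtain ⟨Q, hQ, hQ1, hQ2, hQd⟩ := exists_eq_add_orbitProd_mul M h02 hM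
    have hf0N : ∀ x ∈ N, substVar 1 (X 1 + C x * X 2) (substVar 0 0 f) = substVar 0 0 f :=
      fun x hx => substVar_invariant_substVar_zero h10 h02 (hN x hx)
    obtain ⟨R, hR, hR1, hR2, hRd⟩ := exists_eq_add_orbitProd_mul N h12 hf0N
    rw [hQ, hR]
    refine add_mem (add_mem ?_ (mul_mem (Algebra.subset_adjoin (by simp)) (key R ?_ hR1 ?_)))
      (mul_mem (Algebra.subset_adjoin (by simp)) (key Q hQ1 ?_ ?_))
    · exact Algebra.adjoin_mono (by simp) (substVar_zero_substVar_zero_mem f)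
    · intro x hx
      refine hR2 0 h10.symm h02 x ?_
      rw [substVar_substVar_self, map_zero]
    · intro h0
      have := hRd h0
      have := totalDegree_substVar_zero_le 0 f
      have := Fintype.card_pos (α := N)
      omega
    · exact fun x hx => hQ2 1 h10 h12 x (hN x hx)
    · intro h0
      have := hQd h0
      have := Fintype.card_pos (α := M)
      omega

lemma mem_adjoin_X_of_totalDegree_lt {F : Type u} [Field F] (M N : AddSubgroup F) [Fintype M]
    [Fintype N] {f : MvPolynomial (Fin 3) F}
    (hM : ∀ x ∈ M, substVar 0 (X 0 + C x * X 2) f = f)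
    (hN : ∀ x ∈ N, substVar 1 (X 1 + C x * X 2) f = f)
    (hdM : f.totalDegree < Fintype.card M) (hdN : f.totalDegree < Fintype.card N) :
    f ∈ Algebra.adjoin F {X 2} := by
  obtain ⟨Q, hQ, -, -, hQd⟩ := exists_eq_add_orbitProd_mul M (show (0 : Fin 3) ≠ 2 by decide) hM
  obtain ⟨R, hR, -, -, hRd⟩ := exists_eq_add_orbitProd_mul N (show (1 : Fin 3) ≠ 2 by decide) hN
  have hQ0 : Q = 0 := by
    by_contra h
    have := hQd h
    omega
  have hR0 : R = 0 := by
    by_contra h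
    have := hRd h
    omega
  rw [hQ0, mul_zero, add_zero] at hQ
  rw [hR0, mul_zero, add_zero] at hR
  have := substVar_zero_substVar_zero_mem f
  rwa [← hQ, ← hR] at this

lemma totalDegree_polyAct_le {F : Type u} [Field F] {m : ℕ} (M : Matrix (Fin m) (Fin m) F)
    (f : MvPolynomial (Fin m) F) : (polyAct M f).totalDegree ≤ f.totalDegree :=
  totalDegree_aeval_le _ (fun _ => totalDegree_finsetSum_le fun _ _ =>
    (totalDegree_smul_le _ _).trans (totalDegree_X _).le) f

lemma polyAct_upperMat {F : Type u} [Field F] (x y : F) (f : MvPolynomial (Fin 3) F) :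
    polyAct (upperMat x y) f =
      substVar 0 (X 0 + C x * X 2) (substVar 1 (X 1 + C y * X 2) f) := by
  have : polyAct (upperMat x y) =
      (substVar 0 (X 0 + C x * X 2)).comp (substVar 1 (X 1 + C y * X 2)) := by
    refine algHom_ext fun i => ?_
    fin_cases i <;>
      simp [polyAct, upperMat, substVar, Fin.sum_univ_three, smul_eq_C_mul]
  exact DFunLike.congr_fun this f

lemma substVar_X {F : Type u} [Field F] (i : Fin 3) (f : MvPolynomial (Fin 3) F) :
    substVar i (X i) f = f := by
  simp [substVar]

lemma X_two_dvd_orbitProd_sub {F : Type u} [Field F] (A : AddSubgroup F) [Fintype A] {i : Fin 3}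
    (hi : i ≠ 2) : X 2 ∣ orbitProd A i - X i ^ Fintype.card A := by
  simpa [substVar_two_orbitProd A hi] using sub_dvd_sub_substVar 2 0 (orbitProd A i)

/-- The invariants of the group of the transvections `upperMat (a * x + c * y) (b * x + d * y)`. -/
lemma exists_transvection_invariants (p : ℕ) [Fact p.Prime] {F : Type u} [Field F] [CharP F p]
    {a b c d : F} (hdet : a * d - b * c ≠ 0) (n : ℕ) (M N : AddSubgroup F) [Fintype M] [Fintype N]
    (hM : Fintype.card M = p ^ n) (hN : Fintype.card N = p ^ n) :
    ∃ f₁ f₂ : MvPolynomial (Fin 3) F,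
      (∀ x ∈ M, ∀ y ∈ N, polyAct (upperMat (a * x + c * y) (b * x + d * y)) f₁ = f₁) ∧
      (∀ x ∈ M, ∀ y ∈ N, polyAct (upperMat (a * x + c * y) (b * x + d * y)) f₂ = f₂) ∧
      X 2 ∣ f₁ - X 0 ^ p ^ n ∧ X 2 ∣ f₂ - X 1 ^ p ^ n ∧
      f₁.totalDegree ≤ p ^ n ∧ f₂.totalDegree ≤ p ^ n ∧
      ∀ f : MvPolynomial (Fin 3) F,
        (∀ x ∈ M, ∀ y ∈ N, polyAct (upperMat (a * x + c * y) (b * x + d * y)) f = f) →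
        f ∈ Algebra.adjoin F {f₁, f₂, X 2} ∧
        (f.totalDegree < p ^ n → f ∈ Algebra.adjoin F {X 2}) := by
  have h02 : (0 : Fin 3) ≠ 2 := by decide
  have h12 : (1 : Fin 3) ≠ 2 := by decide
  have h01 : (0 : Fin 3) ≠ 1 := by decide
  set q := p ^ n with hq
  set D := a * d - b * c with hD
  let B : Matrix (Fin 3) (Fin 3) F := !![a, c, 0; b, d, 0; 0, 0, 1]
  let B' : Matrix (Fin 3) (Fin 3) F := !![d / D, -c / D, 0; -b / D, a / D, 0; 0, 0, 1]
  have hBB' : B * B' = 1 := by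
    ext i j
    fin_cases i <;> fin_cases j <;>
      simp [B, B', Matrix.mul_apply, Fin.sum_univ_three] <;> field_simp <;> rw [hD] <;> ring
  have hB'B : B' * B = 1 := mul_eq_one_comm.mp hBB'
  have hTT' : ∀ f, polyAct B (polyAct B' f) = f := fun f => by
    rw [polyAct_polyAct, hB'B, polyAct_one]
  have hT'T : ∀ f, polyAct B' (polyAct B f) = f := fun f => by
    rw [polyAct_polyAct, hBB', polyAct_one]
  have hBU : ∀ x y, B * upperMat x y = upperMat (a * x + c * y) (b * x + d * y) * B := by
    intro x y
    ext i j
    fin_cases i <;> fin_cases j <;> simp [B, upperMat, Matrix.mul_apply, Fin.sum_univ_three]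
  have hB'U : ∀ x y, B' * upperMat (a * x + c * y) (b * x + d * y) = upperMat x y * B' := by
    intro x y
    calc _ = B' * (upperMat (a * x + c * y) (b * x + d * y) * B) * B' := by
          rw [mul_assoc, mul_assoc, hBB', mul_one]
      _ = _ := by rw [← hBU, ← mul_assoc, hB'B, one_mul]
  have hBX0 : polyAct B (X 0) = a • X 0 + c • X 1 := by
    simp [B, polyAct, Fin.sum_univ_three]
  have hBX1 : polyAct B (X 1) = b • X 0 + d • X 1 := by
    simp [B, polyAct, Fin.sum_univ_three]
  have hB'X2 : polyAct B' (X 2) = X 2 := by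
    simp [B', polyAct, Fin.sum_univ_three]
  let n₁ := orbitProd M 0
  let n₂ := orbitProd N 1
  have hinv : ∀ s t : F, ∀ x ∈ M, ∀ y ∈ N,
      polyAct (upperMat (a * x + c * y) (b * x + d * y)) (polyAct B' (s • n₁ + t • n₂)) =
        polyAct B' (s • n₁ + t • n₂) := by
    intro s t x hx y hy
    rw [polyAct_polyAct, hB'U, ← polyAct_polyAct, polyAct_upperMat]
    simp only [map_add, map_smul, n₁, n₂, substVar_orbitProd_of_ne _ h01 h12,
      substVar_orbitProd_of_ne _ h01.symm h02, substVar_orbitProd_self _ h02 hx,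
      substVar_orbitProd_self _ h12 hy]
  have hdvd : ∀ s t : F, ∀ i, polyAct B (X i) = s • X 0 + t • X 1 →
      X 2 ∣ polyAct B' (s ^ q • n₁ + t ^ q • n₂) - X i ^ q := by
    intro s t i hi
    have h1 : X 2 ∣ n₁ - X 0 ^ q := hM ▸ X_two_dvd_orbitProd_sub M h02
    have h2 : X 2 ∣ n₂ - X 1 ^ q := hN ▸ X_two_dvd_orbitProd_sub N h12
    have h3 : X 2 ∣ (s ^ q • n₁ + t ^ q • n₂) - polyAct B (X i ^ q) := by
      have : (s ^ q • n₁ + t ^ q • n₂) - polyAct B (X i ^ q) =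
          s ^ q • (n₁ - X 0 ^ q) + t ^ q • (n₂ - X 1 ^ q) := by
        rw [map_pow, hi, hq, add_pow_char_pow, smul_pow, smul_pow, smul_sub, smul_sub]
        ring
      rw [this]
      exact dvd_add (dvd_smul_of_dvd _ h1) (dvd_smul_of_dvd _ h2)
    have h4 := map_dvd (polyAct B') h3
    rwa [map_sub, hT'T, hB'X2] at h4
  have hdeg : ∀ s t : F, (polyAct B' (s • n₁ + t • n₂)).totalDegree ≤ q := by
    intro s t
    refine (totalDegree_polyAct_le _ _).trans ((totalDegree_add _ _).trans (max_le ?_ ?_))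
    · exact (totalDegree_smul_le _ _).trans (hM ▸ (isHomogeneous_orbitProd M 0).totalDegree_le)
    · exact (totalDegree_smul_le _ _).trans (hN ▸ (isHomogeneous_orbitProd N 1).totalDegree_le)
  refine ⟨polyAct B' (a ^ q • n₁ + c ^ q • n₂), polyAct B' (b ^ q • n₁ + d ^ q • n₂),
    hinv _ _, hinv _ _, hdvd _ _ 0 hBX0, hdvd _ _ 1 hBX1, hdeg _ _, hdeg _ _, fun f hf => ?_⟩
  have hT : ∀ x ∈ M, ∀ y ∈ N, polyAct (upperMat x y) (polyAct B f) = polyAct B f := by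
    intro x hx y hy
    rw [polyAct_polyAct, hBU, ← polyAct_polyAct, hf x hx y hy]
  have hTM : ∀ x ∈ M, substVar 0 (X 0 + C x * X 2) (polyAct B f) = polyAct B f := by
    intro x hx
    have := hT x hx 0 N.zero_mem
    rwa [polyAct_upperMat, C_0, zero_mul, add_zero, substVar_X] at this
  have hTN : ∀ y ∈ N, substVar 1 (X 1 + C y * X 2) (polyAct B f) = polyAct B f := by
    intro y hy
    have := hT 0 M.zero_mem y hy
    rwa [polyAct_upperMat, C_0, zero_mul, add_zero, substVar_X] at this
  have hDq : a ^ q * d ^ q - b ^ q * c ^ q = D ^ q := by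
    rw [hD, hq, sub_pow_char_pow, mul_pow, mul_pow]
  have hDq0 : D ^ q ≠ 0 := pow_ne_zero _ hdet
  constructor
  · have h := mem_adjoin_of_translation_invariant M N hTM hTN
    have h' : polyAct B' (polyAct B f) ∈
        (Algebra.adjoin F {orbitProd M 0, orbitProd N 1, X 2}).map (polyAct B') := ⟨_, h, rfl⟩
    rw [hT'T, AlgHom.map_adjoin] at h'
    refine Algebra.adjoin_le ?_ h'
    have e1 : polyAct B' n₁ = (D ^ q)⁻¹ • (d ^ q • polyAct B' (a ^ q • n₁ + c ^ q • n₂) -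
        c ^ q • polyAct B' (b ^ q • n₁ + d ^ q • n₂)) := by
      rw [eq_inv_smul_iff₀ hDq0, ← hDq]
      simp only [map_add, map_smul]
      module
    have e2 : polyAct B' n₂ = (D ^ q)⁻¹ • (a ^ q • polyAct B' (b ^ q • n₁ + d ^ q • n₂) -
        b ^ q • polyAct B' (a ^ q • n₁ + c ^ q • n₂)) := by
      rw [eq_inv_smul_iff₀ hDq0, ← hDq]
      simp only [map_add, map_smul]
      module
    rintro _ ⟨y, hy, rfl⟩
    rcases hy with rfl | rfl | rfl
    · change polyAct B' n₁ ∈ _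
      rw [e1]
      refine Subalgebra.smul_mem _ (sub_mem (Subalgebra.smul_mem _ ?_ _)
        (Subalgebra.smul_mem _ ?_ _)) _ <;> exact Algebra.subset_adjoin (by simp)
    · change polyAct B' n₂ ∈ _
      rw [e2]
      refine Subalgebra.smul_mem _ (sub_mem (Subalgebra.smul_mem _ ?_ _)
        (Subalgebra.smul_mem _ ?_ _)) _ <;> exact Algebra.subset_adjoin (by simp)
    · rw [hB'X2]
      exact Algebra.subset_adjoin (by simp)
  · intro hlt
    have hlt' : (polyAct B f).totalDegree < q := (totalDegree_polyAct_le _ _).trans_lt hlt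
    have h := mem_adjoin_X_of_totalDegree_lt M N hTM hTN (hM ▸ hlt') (hN ▸ hlt')
    have h' : polyAct B' (polyAct B f) ∈ (Algebra.adjoin F {X 2}).map (polyAct B') := ⟨_, h, rfl⟩
    rwa [hT'T, AlgHom.map_adjoin, Set.image_singleton, hB'X2] at h'

lemma injective_aeval_of_X_two_dvd {F : Type u} [Field F] {q : ℕ} (hq : 0 < q)
    {f₁ f₂ : MvPolynomial (Fin 3) F} (h₁ : X 2 ∣ f₁ - X 0 ^ q) (h₂ : X 2 ∣ f₂ - X 1 ^ q) :
    Function.Injective (aeval (R := F) ![f₁, f₂, X 2]) := by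
  have hzero : ∀ (i : Fin 3) (f : MvPolynomial (Fin 3) F), i ≠ 2 → X 2 ∣ f - X i ^ q →
      substVar 2 0 f = X i ^ q := by
    rintro i f hi ⟨g, hg⟩
    have := congrArg (substVar 2 0) hg
    rwa [map_mul, substVar_X_self, zero_mul, map_sub, map_pow, substVar_X_of_ne hi,
      sub_eq_zero] at this
  have hcomm : ∀ P, substVar 2 0 (aeval (R := F) ![f₁, f₂, X 2] P) =
      expand q (substVar 2 0 P) := by
    intro P
    have : (substVar 2 0).comp (aeval (R := F) ![f₁, f₂, X 2]) =
        (expand q).comp (substVar 2 0) := by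
      refine algHom_ext fun i => ?_
      fin_cases i
      · simp [substVar_X_of_ne (show (0 : Fin 3) ≠ 2 by decide), hzero 0 f₁ (by decide) h₁]
      · simp [substVar_X_of_ne (show (1 : Fin 3) ≠ 2 by decide), hzero 1 f₂ (by decide) h₂]
      · simp [substVar_X_self]
    exact DFunLike.congr_fun this P
  rw [injective_iff_map_eq_zero]
  intro P hP
  induction hd : P.totalDegree using Nat.strong_induction_on generalizing P with
  | _ d ih =>
    by_contra hP0
    have h := hcomm P
    rw [hP, map_zero, eq_comm, expand_eq_zero hq] at h
    obtain ⟨Q, hQ⟩ : X 2 ∣ P := by simpa [h] using sub_dvd_sub_substVar 2 0 P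
    have hQ0 : Q ≠ 0 := by
      rintro rfl
      exact hP0 (by rw [hQ, mul_zero])
    refine hQ0 (ih _ ?_ Q ?_ rfl)
    · rw [← hd, hQ, totalDegree_mul_of_isDomain (X_ne_zero _) hQ0, totalDegree_X]
      omega
    · rw [hQ, map_mul, aeval_X, mul_eq_zero] at hP
      exact hP.resolve_left (X_ne_zero 2)

/-- Averaging over a quotient of order invertible in `F` produces a semi-invariant. -/
lemma exists_semi_invariant {F S Γ : Type*} [Field F] [AddCommGroup S] [Module F S] [Group Γ]
    [Finite Γ] (A : Γ → S →ₗ[F] S) (hA : ∀ g h s, A g (A h s) = A (h * g) s) (χ : Γ →* F)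
    (K : Subgroup Γ) [K.Normal] (hK : ∀ k ∈ K, χ k = 1) (hcard : (Nat.card (Γ ⧸ K) : F) ≠ 0)
    {f : S} (hf : ∀ k ∈ K, A k f = f) (V : Submodule F S) (hV : ∀ g, A g f - χ g • f ∈ V) :
    ∃ f', (∀ g, A g f' = χ g • f') ∧ f' - f ∈ V := by
  have := Fintype.ofFinite (Γ ⧸ K)
  have hχ : ∀ g, χ g ≠ 0 := fun g => ((Group.isUnit g).map χ).ne_zero
  let φ : Γ → S := fun g => (χ g)⁻¹ • A g f
  have hφ : ∀ g k, k ∈ K → φ (k * g) = φ g := by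
    intro g k hk
    simp only [φ]
    rw [map_mul, hK k hk, one_mul, ← hA, hf k hk]
  have hout : ∀ g : Γ, φ (g : Γ ⧸ K).out = φ g := by
    intro g
    obtain ⟨k, hk⟩ := QuotientGroup.mk_out_eq_mul K g
    rw [hk, ← hφ g _ (‹K.Normal›.conj_mem k k.2 g)]
    congr 1
    group
  have hact : ∀ g h, A g (φ h) = χ g • φ (h * g) := by
    intro g h
    simp only [φ]
    rw [map_smul, hA, smul_smul, map_mul, _root_.mul_inv_rev, mul_inv_cancel_left₀ (hχ g)]
  refine ⟨(Nat.card (Γ ⧸ K) : F)⁻¹ • ∑ x : Γ ⧸ K, φ x.out, fun g => ?_, ?_⟩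
  · rw [map_smul, map_sum, smul_comm]
    congr 1
    simp only [hact]
    rw [← Finset.smul_sum]
    congr 1
    refine Fintype.sum_equiv (Equiv.mulRight (g : Γ ⧸ K)) _ _ fun x => ?_
    rw [Equiv.coe_mulRight, ← hout]
    congr 2
    rw [QuotientGroup.mk_mul, QuotientGroup.out_eq']
  · have : (Nat.card (Γ ⧸ K) : F)⁻¹ • ∑ x : Γ ⧸ K, φ x.out - f =
        (Nat.card (Γ ⧸ K) : F)⁻¹ • ∑ x : Γ ⧸ K, (χ x.out)⁻¹ • (A x.out f - χ x.out • f) := by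
      simp only [smul_sub, Finset.sum_sub_distrib, inv_smul_smul₀ (hχ _), Finset.sum_const,
        Finset.card_univ, φ]
      rw [← Nat.card_eq_fintype_card, ← Nat.cast_smul_eq_nsmul F, inv_smul_smul₀ hcard]
    rw [this]
    exact V.smul_mem _ (V.sum_mem fun x _ => V.smul_mem _ (hV _))

/-- The diagonal entries of a group of matrices of block shape. -/
def diagHom {F : Type u} [Field F] (G : Subgroup (Matrix.SpecialLinearGroup (Fin 3) F))
    (hblock : ∀ g ∈ G, (g : Matrix (Fin 3) (Fin 3) F) 0 1 = 0 ∧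
      (g : Matrix (Fin 3) (Fin 3) F) 1 0 = 0 ∧ (g : Matrix (Fin 3) (Fin 3) F) 2 0 = 0 ∧
      (g : Matrix (Fin 3) (Fin 3) F) 2 1 = 0) : G →* (Fin 3 → F) where
  toFun g i := (g : Matrix (Fin 3) (Fin 3) F) i i
  map_one' := by ext i; simp
  map_mul' g h := by
    obtain ⟨g1, g2, g3, g4⟩ := hblock g g.2
    obtain ⟨h1, h2, h3, h4⟩ := hblock h h.2
    ext i
    fin_cases i <;> simp [Matrix.mul_apply, Fin.sum_univ_three, *]

lemma diagHom_apply {F : Type u} [Field F] (G : Subgroup (Matrix.SpecialLinearGroup (Fin 3) F))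
    (hblock : ∀ g ∈ G, (g : Matrix (Fin 3) (Fin 3) F) 0 1 = 0 ∧
      (g : Matrix (Fin 3) (Fin 3) F) 1 0 = 0 ∧ (g : Matrix (Fin 3) (Fin 3) F) 2 0 = 0 ∧
      (g : Matrix (Fin 3) (Fin 3) F) 2 1 = 0) (g : G) (i : Fin 3) :
    diagHom G hblock g i = (g : Matrix (Fin 3) (Fin 3) F) i i := rfl

lemma natCard_quotient_ker_ne_zero (p : ℕ) [Fact p.Prime] {F : Type u} [Field F] [CharP F p]
    {Γ : Type*} [Group Γ] [Finite Γ] {ι : Type*} (D : Γ →* (ι → F)) :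
    (Nat.card (Γ ⧸ D.ker) : F) ≠ 0 := by
  rw [Ne, CharP.cast_eq_zero_iff F p]
  intro hdvd
  obtain ⟨x, hx⟩ := exists_prime_orderOf_dvd_card' p hdvd
  obtain ⟨g, rfl⟩ := QuotientGroup.mk_surjective x
  have h1 : ((g ^ p : Γ) : Γ ⧸ D.ker) = 1 := by
    rw [QuotientGroup.mk_pow, ← hx, pow_orderOf_eq_one]
  rw [QuotientGroup.eq_one_iff, MonoidHom.mem_ker, map_pow] at h1
  have h2 : D g = 1 := by
    ext i
    have h3 := congrFun h1 i
    rw [Pi.pow_apply, Pi.one_apply] at h3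
    exact (frobenius_inj F p) (by rw [frobenius_def, h3, Pi.one_apply, map_one])
  rw [(QuotientGroup.eq_one_iff g).mpr h2, orderOf_one] at hx
  exact (Fact.out : p.Prime).one_lt.ne hx

lemma nonempty_ringEquiv_of_transvections (p : ℕ) [Fact p.Prime] {F : Type u} [Field F] [CharP F p]
    (G : Subgroup (Matrix.SpecialLinearGroup (Fin 3) F)) [Finite G]
    (hblock : ∀ g ∈ G, (g : Matrix (Fin 3) (Fin 3) F) 0 1 = 0 ∧
      (g : Matrix (Fin 3) (Fin 3) F) 1 0 = 0 ∧ (g : Matrix (Fin 3) (Fin 3) F) 2 0 = 0 ∧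
      (g : Matrix (Fin 3) (Fin 3) F) 2 1 = 0)
    {a b c d : F} (hdet : a * d - b * c ≠ 0) (n : ℕ) (M N : AddSubgroup F) [Fintype M] [Fintype N]
    (hM : Fintype.card M = p ^ n) (hN : Fintype.card N = p ^ n)
    (hker : ∀ g : G, g ∈ (diagHom G hblock).ker → ∃ x ∈ M, ∃ y ∈ N,
      (g : Matrix (Fin 3) (Fin 3) F) = upperMat (a * x + c * y) (b * x + d * y))
    (hmem : ∀ x ∈ M, ∀ y ∈ N, ∃ g : G,
      (g : Matrix (Fin 3) (Fin 3) F) = upperMat (a * x + c * y) (b * x + d * y)) :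
    Nonempty (monomialSubalgebra F (charMonoid fun g : G =>
      ![(g : Matrix (Fin 3) (Fin 3) F) 0 0 ^ p ^ n, (g : Matrix (Fin 3) (Fin 3) F) 1 1 ^ p ^ n,
        (g : Matrix (Fin 3) (Fin 3) F) 2 2]) ≃+* invariantRing G) := by
  obtain ⟨f₁, f₂, hi₁, hi₂, hd₁, hd₂, ht₁, ht₂, hinv⟩ :=
    exists_transvection_invariants p hdet n M N hM hN
  set q := p ^ n with hq
  have hq0 : 0 < q := pow_pos (Fact.out : p.Prime).pos n
  set K := (diagHom G hblock).ker
  let A : G → MvPolynomial (Fin 3) F →ₗ[F] MvPolynomial (Fin 3) F := fun g =>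
    (polyAct (g : Matrix (Fin 3) (Fin 3) F)).toLinearMap
  have hA : ∀ g f, A g f = polyAct (g : Matrix (Fin 3) (Fin 3) F) f := fun g f => rfl
  have hAA : ∀ g h f, A g (A h f) = A (h * g) f := by
    intro g h f
    rw [hA, hA, hA, polyAct_polyAct]
    rfl
  have hAX : ∀ (g : G), A g (X 2) = (g : Matrix (Fin 3) (Fin 3) F) 2 2 • X 2 := by
    intro g
    obtain ⟨-, -, h3, h4⟩ := hblock g g.2
    simp [hA, polyAct, Fin.sum_univ_three, h3, h4]
  have hKX : ∀ k ∈ K, ∀ i, (k : Matrix (Fin 3) (Fin 3) F) i i = 1 := by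
    intro k hk i
    rw [← diagHom_apply G hblock, MonoidHom.mem_ker.mp hk, Pi.one_apply]
  have hKinv : ∀ f, (∀ x ∈ M, ∀ y ∈ N,
      polyAct (upperMat (a * x + c * y) (b * x + d * y)) f = f) → ∀ k ∈ K, A k f = f := by
    intro f hf k hk
    obtain ⟨x, hx, y, hy, hxy⟩ := hker k hk
    rw [hA, hxy, hf x hx y hy]
  have hinvK : ∀ f, (∀ k ∈ K, A k f = f) → ∀ x ∈ M, ∀ y ∈ N,
      polyAct (upperMat (a * x + c * y) (b * x + d * y)) f = f := by
    intro f hf x hx y hy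
    obtain ⟨g, hg⟩ := hmem x hx y hy
    rw [← hg]
    refine hf g ?_
    rw [MonoidHom.mem_ker]
    ext i
    rw [diagHom_apply, hg]
    fin_cases i <;> rfl
  let V : Submodule F (MvPolynomial (Fin 3) F) :=
    Subalgebra.toSubmodule (Algebra.adjoin F {X 2}) ⊓
      (Ideal.span {(X 2 : MvPolynomial (Fin 3) F)}).restrictScalars F
  have hVmem : ∀ f, f ∈ V ↔ f ∈ Algebra.adjoin F {X 2} ∧ X 2 ∣ f := by
    intro f
    rw [← Ideal.mem_span_singleton]
    rfl
  let χ : Fin 3 → G →* F := fun i => (Pi.evalMonoidHom (fun _ => F) i).comp (diagHom G hblock)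
  have hχ : ∀ i g, χ i g = (g : Matrix (Fin 3) (Fin 3) F) i i := fun i g => rfl
  have hV : ∀ (f : MvPolynomial (Fin 3) F) (i : Fin 3),
      (∀ g : G, ∃ t : F, A g (X i) = χ i g • X i + t • X 2) → (∀ k ∈ K, A k f = f) →
      X 2 ∣ f - X i ^ q → f.totalDegree ≤ q → ∀ g, A g f - (χ i g) ^ q • f ∈ V := by
    rintro f i hX hf ⟨h, hh⟩ hdeg g
    obtain ⟨t, ht⟩ := hX g
    obtain ⟨h', hh'⟩ : X 2 ∣ A g f - (χ i g) ^ q • f := by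
      have e1 : f = X i ^ q + X 2 * h := by rw [← hh]; ring
      have e2 : A g f - (χ i g) ^ q • f = X 2 * (t ^ q • X 2 ^ (q - 1) +
          (g : Matrix (Fin 3) (Fin 3) F) 2 2 • A g h - (χ i g) ^ q • h) := by
        conv_lhs => rw [e1]
        have e3 : A g (X i ^ q + X 2 * h) = A g (X i) ^ q + A g (X 2) * A g h := by
          simp [hA]
        have e4 : (X 2 : MvPolynomial (Fin 3) F) ^ q = X 2 * X 2 ^ (q - 1) := by
          rw [← pow_succ', Nat.sub_add_cancel hq0]
        rw [e3, ht, hAX, hq, add_pow_char_pow, ← hq, smul_pow, smul_pow, e4]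
        simp only [smul_eq_C_mul]
        ring
      exact ⟨_, e2⟩
    have hk : ∀ k ∈ K, A k (A g f - (χ i g) ^ q • f) = A g f - (χ i g) ^ q • f := by
      intro k hk
      have hconj : g * k * g⁻¹ ∈ K := (inferInstance : K.Normal).conj_mem k hk g
      have h1 : A k (A g f) = A g f := by
        have h2 : A g (A (g * k * g⁻¹) f) = A k (A g f) := by
          rw [hAA, hAA, inv_mul_cancel_right]
        rw [← h2, hf _ hconj]
      rw [map_sub, map_smul, h1, hf k hk]
    have hk' : ∀ k ∈ K, A k h' = h' := by
      intro k hkK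
      have h1 := hk k hkK
      have h2 : A k (X 2 * h') = A k (X 2) * A k h' := by simp [hA]
      rw [hh', h2, hAX, hKX k hkK, one_smul] at h1
      exact mul_left_cancel₀ (X_ne_zero _) h1
    have hdeg' : (A g f - (χ i g) ^ q • f).totalDegree ≤ q :=
      (totalDegree_sub _ _).trans (max_le ((totalDegree_polyAct_le _ _).trans hdeg)
        ((totalDegree_smul_le _ _).trans hdeg))
    rw [hVmem]
    refine ⟨?_, ⟨h', hh'⟩⟩
    rw [hh']
    refine mul_mem (Algebra.subset_adjoin rfl) ?_
    rcases eq_or_ne h' 0 with h0 | h0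
    · rw [h0]
      exact zero_mem _
    · rw [hh', totalDegree_mul_of_isDomain (X_ne_zero _) h0, totalDegree_X] at hdeg'
      exact (hinv h' (hinvK h' hk')).2 (by omega)
  have hcard : (Nat.card (G ⧸ K) : F) ≠ 0 := natCard_quotient_ker_ne_zero p _
  have hsemi : ∀ (f : MvPolynomial (Fin 3) F) (i : Fin 3),
      (∀ g : G, ∃ t : F, A g (X i) = χ i g • X i + t • X 2) → (∀ k ∈ K, A k f = f) →
      X 2 ∣ f - X i ^ q → f.totalDegree ≤ q →
      ∃ f', (∀ g, A g f' = (χ i g) ^ q • f') ∧ f' - f ∈ V := by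
    intro f i hX hf hd ht
    exact exists_semi_invariant A hAA ((powMonoidHom q).comp (χ i)) K
      (fun k hk => by simp [hχ, hKX k hk]) hcard hf V (hV f i hX hf hd ht)
  obtain ⟨f₁', hs₁, hv₁⟩ := hsemi f₁ 0 (fun g => ⟨(g : Matrix (Fin 3) (Fin 3) F) 0 2, by
    simp [hA, hχ, polyAct, Fin.sum_univ_three, (hblock g g.2).1]⟩) (hKinv f₁ hi₁) hd₁ ht₁
  obtain ⟨f₂', hs₂, hv₂⟩ := hsemi f₂ 1 (fun g => ⟨(g : Matrix (Fin 3) (Fin 3) F) 1 2, by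
    simp [hA, hχ, polyAct, Fin.sum_univ_three, (hblock g g.2).2.1]⟩) (hKinv f₂ hi₂) hd₂ ht₂
  rw [hVmem] at hv₁ hv₂
  refine nonempty_ringEquiv_invariantRing G _ (aeval ![f₁', f₂', X 2])
    (injective_aeval_of_X_two_dvd hq0 ?_ ?_) ?_ ?_
  · rw [← sub_add_sub_cancel]
    exact dvd_add hv₁.2 hd₁
  · rw [← sub_add_sub_cancel]
    exact dvd_add hv₂.2 hd₂
  · intro g i
    fin_cases i
    · simpa [hA, hχ] using hs₁ g
    · simpa [hA, hχ] using hs₂ g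
    · simpa [hA] using hAX g
  · intro P hP
    have h := (hinv P (hinvK P fun k _ => hP _ ⟨k, k.2, rfl⟩)).1
    refine Algebra.adjoin_le ?_ h
    have hX : Algebra.adjoin F {X 2} ≤ (aeval (R := F) ![f₁', f₂', X 2]).range :=
      Algebra.adjoin_le (by rintro _ rfl; exact ⟨X 2, by simp⟩)
    intro y hy
    rcases hy with h | h | h
    · rw [h, ← sub_sub_self f₁' f₁]
      exact sub_mem ⟨X 0, by simp⟩ (hX hv₁.1)
    · rw [h, ← sub_sub_self f₂' f₂]
      exact sub_mem ⟨X 1, by simp⟩ (hX hv₂.1)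
    · rw [h]
      exact hX (Algebra.subset_adjoin rfl)

/-- The matrix `upperMat x y` as an element of the special linear group. -/
def upperSL {F : Type u} [Field F] (x y : F) : Matrix.SpecialLinearGroup (Fin 3) F :=
  ⟨upperMat x y, by simp [upperMat, Matrix.det_fin_three]⟩

lemma coe_upperSL {F : Type u} [Field F] (x y : F) :
    (upperSL x y : Matrix (Fin 3) (Fin 3) F) = upperMat x y := rfl

lemma upperSL_zero {F : Type u} [Field F] : upperSL (0 : F) 0 = 1 := by
  ext i j
  fin_cases i <;> fin_cases j <;> simp [coe_upperSL, upperMat]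

lemma upperSL_mul {F : Type u} [Field F] (x y x' y' : F) :
    upperSL x y * upperSL x' y' = upperSL (x + x') (y + y') := by
  ext i j
  fin_cases i <;> fin_cases j <;>
    simp [coe_upperSL, upperMat, Matrix.mul_apply, Fin.sum_univ_three, add_comm]

lemma upperSL_inv {F : Type u} [Field F] (x y : F) : (upperSL x y)⁻¹ = upperSL (-x) (-y) := by
  rw [inv_eq_iff_mul_eq_one, upperSL_mul, add_neg_cancel, add_neg_cancel, upperSL_zero]

lemma isTransvectionMat_upperMat {F : Type u} [Field F] {x y : F} (h : ¬ (x = 0 ∧ y = 0)) :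
    IsTransvectionMat (upperMat x y) := by
  have h1 : upperMat x y - 1 = Matrix.vecMulVec ![x, y, 0] ![0, 0, 1] := by
    ext i j
    fin_cases i <;> fin_cases j <;> simp [upperMat, Matrix.vecMulVec_apply]
  refine ⟨le_antisymm (h1 ▸ Matrix.rank_vecMulVec_le _ _) ?_, ?_⟩
  · rw [Nat.one_le_iff_ne_zero, Ne, Matrix.rank, Submodule.finrank_eq_zero, LinearMap.range_eq_bot]
    intro h0
    have h2 := DFunLike.congr_fun h0 (Pi.single 2 1)
    refine h ⟨?_, ?_⟩
    · simpa [upperMat] using congrFun h2 0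
    · simpa [upperMat] using congrFun h2 1
  · ext i j
    fin_cases i <;> fin_cases j <;> simp [upperMat, Matrix.mul_apply, Fin.sum_univ_three]

/-- The scalars `x` such that the matrix `upperMat (a * x) (b * x)` lies in a given group. -/
def upperParam {F : Type u} [Field F] (T : Subgroup (Matrix.SpecialLinearGroup (Fin 3) F))
    (a b : F) : AddSubgroup F where
  carrier := {x | upperSL (a * x) (b * x) ∈ T}
  zero_mem' := by simp [upperSL_zero, T.one_mem]
  add_mem' {x y} hx hy := by
    have := T.mul_mem hx hy
    rwa [upperSL_mul, ← mul_add, ← mul_add] at this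
  neg_mem' {x} hx := by
    have := T.inv_mem hx
    rwa [upperSL_inv, ← mul_neg, ← mul_neg] at this

lemma card_span_of_forall_dvd (p : ℕ) [Fact p.Prime] {F : Type u} [Field F] [CharP F p]
    [Algebra (ZMod p) F] {n : ℕ} (μ : Fin n → F)
    (hμ : ∀ e : Fin n → ℕ, ∑ i, (e i : F) * μ i = 0 → ∀ i, p ∣ e i) :
    Finite (Submodule.span (ZMod p) (Set.range μ)) ∧
      Nat.card (Submodule.span (ZMod p) (Set.range μ)) = p ^ n := by
  have hli : LinearIndependent (ZMod p) μ := by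
    rw [Fintype.linearIndependent_iff]
    intro g hg i
    rw [← ZMod.natCast_zmod_val (g i), ZMod.natCast_eq_zero_iff]
    refine hμ (fun i => (g i).val) ?_ i
    rw [← hg]
    refine Finset.sum_congr rfl fun j _ => ?_
    rw [Algebra.smul_def, ← ZMod.natCast_zmod_val (g j), map_natCast, ZMod.natCast_zmod_val]
  have hfin : Module.Finite (ZMod p) (Submodule.span (ZMod p) (Set.range μ)) :=
    Module.Finite.span_of_finite _ (Set.finite_range μ)
  refine ⟨Module.finite_of_finite (ZMod p), ?_⟩
  rw [Module.natCard_eq_pow_finrank (K := ZMod p), finrank_span_eq_card hli, Nat.card_zmod,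
    Fintype.card_fin]

lemma span_le_upperParam (p : ℕ) {F : Type u} [Field F] [Algebra (ZMod p) F]
    (T : Subgroup (Matrix.SpecialLinearGroup (Fin 3) F)) (a b : F) {n : ℕ} (μ : Fin n → F)
    (h : ∀ i, upperSL (a * μ i) (b * μ i) ∈ T) :
    (Submodule.span (ZMod p) (Set.range μ)).toAddSubgroup ≤ upperParam T a b := by
  have : Submodule.span (ZMod p) (Set.range μ) ≤
      AddSubgroup.toZModSubmodule p (upperParam T a b) :=
    Submodule.span_le.mpr (by rintro _ ⟨i, rfl⟩; exact h i)
  exact this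

lemma exists_upperMat_of_mem_closure {F : Type u} [Field F] {a b c d : F} (M N : AddSubgroup F)
    {S : Set (Matrix.SpecialLinearGroup (Fin 3) F)}
    (hS : ∀ g ∈ S, ∃ x ∈ M, ∃ y ∈ N, g = upperSL (a * x + c * y) (b * x + d * y))
    {g : Matrix.SpecialLinearGroup (Fin 3) F} (hg : g ∈ Subgroup.closure S) :
    ∃ x ∈ M, ∃ y ∈ N, g = upperSL (a * x + c * y) (b * x + d * y) := by
  induction hg using Subgroup.closure_induction with
  | mem g hg => exact hS g hg
  | one => exact ⟨0, M.zero_mem, 0, N.zero_mem, by simp [upperSL_zero]⟩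
  | mul g h _ _ hg hh =>
    obtain ⟨x, hx, y, hy, rfl⟩ := hg
    obtain ⟨x', hx', y', hy', rfl⟩ := hh
    refine ⟨x + x', M.add_mem hx hx', y + y', N.add_mem hy hy', ?_⟩
    rw [upperSL_mul]
    congr 1 <;> ring
  | inv g _ hg =>
    obtain ⟨x, hx, y, hy, rfl⟩ := hg
    refine ⟨-x, M.neg_mem hx, -y, N.neg_mem hy, ?_⟩
    rw [upperSL_inv]
    congr 1 <;> ring

lemma mem_transSubgroup_of_mem_ker {F : Type u} [Field F]
    (G : Subgroup (Matrix.SpecialLinearGroup (Fin 3) F))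
    (hblock : ∀ g ∈ G, (g : Matrix (Fin 3) (Fin 3) F) 0 1 = 0 ∧
      (g : Matrix (Fin 3) (Fin 3) F) 1 0 = 0 ∧ (g : Matrix (Fin 3) (Fin 3) F) 2 0 = 0 ∧
      (g : Matrix (Fin 3) (Fin 3) F) 2 1 = 0)
    {g : G} (hg : g ∈ (diagHom G hblock).ker) :
    (g : Matrix.SpecialLinearGroup (Fin 3) F) ∈ transSubgroup G := by
  rw [MonoidHom.mem_ker] at hg
  have hd (i : Fin 3) : (g : Matrix (Fin 3) (Fin 3) F) i i = 1 := congrFun hg i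
  obtain ⟨g1, g2, g3, g4⟩ := hblock g g.2
  have h : (g : Matrix.SpecialLinearGroup (Fin 3) F) =
      upperSL ((g : Matrix (Fin 3) (Fin 3) F) 0 2) ((g : Matrix (Fin 3) (Fin 3) F) 1 2) := by
    ext i j
    fin_cases i <;> fin_cases j <;> simp [coe_upperSL, upperMat, *]
  by_cases h0 : (g : Matrix (Fin 3) (Fin 3) F) 0 2 = 0 ∧ (g : Matrix (Fin 3) (Fin 3) F) 1 2 = 0
  · rw [h, h0.1, h0.2, upperSL_zero]
    exact one_mem _
  · refine Subgroup.subset_closure ⟨g.2, ?_⟩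
    rw [h]
    exact isTransvectionMat_upperMat h0

lemma pow_ordCompl_eq_one (p : ℕ) [Fact p.Prime] {F : Type u} [Field F] [CharP F p] {x : F} {k : ℕ}
    (hx : x ^ k = 1) : x ^ (k / p ^ k.factorization p) = 1 := by
  apply iterateFrobenius_inj F p (k.factorization p)
  rw [iterateFrobenius_def, iterateFrobenius_def, ← pow_mul, one_pow,
    Nat.div_mul_cancel (Nat.ordProj_dvd k p), hx]

/-- Chapter B case 2 with `n₁ = n₂`: `S(V)^G` is Gorenstein iff
`λ₂(g)^{p^{n₁}} · λ₁(g)^{p^{n₁}} · λ(g) = 1` for all `g ∈ G`. -/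
theorem stmt12 (p : ℕ) [Fact p.Prime] (F : Type u) [Field F] [CharP F p]
    (G : Subgroup (Matrix.SpecialLinearGroup (Fin 3) F)) [Finite G]
    (hblock : ∀ g ∈ G, (g : Matrix (Fin 3) (Fin 3) F) 0 1 = 0 ∧
      (g : Matrix (Fin 3) (Fin 3) F) 1 0 = 0 ∧ (g : Matrix (Fin 3) (Fin 3) F) 2 0 = 0 ∧
      (g : Matrix (Fin 3) (Fin 3) F) 2 1 = 0)
    (a b c d : F) (habcd : LinearIndependent F ![![a, b], ![c, d]])
    (n₁ n₂ : ℕ) (hn₁ : 0 < n₁) (hn₂ : 0 < n₂)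
    (μ : Fin n₁ → F) (α : Fin n₂ → F)
    (hμ : ∀ e : Fin n₁ → ℕ, ∑ i, (e i : F) * μ i = 0 → ∀ i, (p : ℕ) ∣ e i)
    (hα : ∀ e : Fin n₂ → ℕ, ∑ j, (e j : F) * α j = 0 → ∀ j, (p : ℕ) ∣ e j)
    (hTG : transSubgroup G = Subgroup.closure
      ({g : Matrix.SpecialLinearGroup (Fin 3) F |
          ∃ i : Fin n₁, (g : Matrix (Fin 3) (Fin 3) F) = upperMat (a * μ i) (b * μ i)} ∪
        {g : Matrix.SpecialLinearGroup (Fin 3) F |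
          ∃ j : Fin n₂, (g : Matrix (Fin 3) (Fin 3) F) = upperMat (c * α j) (d * α j)}))
    (heq : n₁ = n₂) :
    IsGorensteinRing ↥(invariantRing G) ↔
      ∀ g ∈ G, ((g : Matrix (Fin 3) (Fin 3) F) 0 0) ^ (p ^ n₁) *
        ((g : Matrix (Fin 3) (Fin 3) F) 1 1) ^ (p ^ n₁) *
        (g : Matrix (Fin 3) (Fin 3) F) 2 2 = 1 := by
  subst heq
  let _ : Algebra (ZMod p) F := ZMod.algebra F p
  have hdet : a * d - b * c ≠ 0 := by
    intro h0
    have h := (Matrix.linearIndependent_rows_iff_isUnit (A := !![a, b; c, d])).mp habcd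
    rw [Matrix.isUnit_iff_isUnit_det, Matrix.det_fin_two_of, h0] at h
    exact not_isUnit_zero h
  obtain ⟨hMf, hM⟩ := card_span_of_forall_dvd p μ hμ
  obtain ⟨hNf, hN⟩ := card_span_of_forall_dvd p α hα
  let M := (Submodule.span (ZMod p) (Set.range μ)).toAddSubgroup
  let N := (Submodule.span (ZMod p) (Set.range α)).toAddSubgroup
  let _ : Fintype M := @Fintype.ofFinite M hMf
  let _ : Fintype N := @Fintype.ofFinite N hNf
  have hle : transSubgroup G ≤ G := (Subgroup.closure_le G).mpr fun g hg => hg.1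
  have hMG : M ≤ upperParam G a b := span_le_upperParam p G a b μ fun i =>
    hle (hTG ▸ Subgroup.subset_closure (Or.inl ⟨i, rfl⟩))
  have hNG : N ≤ upperParam G c d := span_le_upperParam p G c d α fun j =>
    hle (hTG ▸ Subgroup.subset_closure (Or.inr ⟨j, rfl⟩))
  obtain ⟨e⟩ := nonempty_ringEquiv_of_transvections p G hblock hdet n₁ M N
    (Nat.card_eq_fintype_card.symm.trans hM) (Nat.card_eq_fintype_card.symm.trans hN)
    (fun g hg => by
      have h := mem_transSubgroup_of_mem_ker G hblock hg
      rw [hTG] at h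
      obtain ⟨x, hx, y, hy, hxy⟩ := exists_upperMat_of_mem_closure (a := a) (b := b) (c := c)
        (d := d) M N (by
          rintro g (⟨i, hi⟩ | ⟨j, hj⟩)
          · exact ⟨μ i, Submodule.subset_span ⟨i, rfl⟩, 0, N.zero_mem,
              Subtype.ext (by simpa [coe_upperSL] using hi)⟩
          · exact ⟨0, M.zero_mem, α j, Submodule.subset_span ⟨j, rfl⟩,
              Subtype.ext (by simpa [coe_upperSL] using hj)⟩) h
      exact ⟨x, hx, y, hy, congrArg Subtype.val hxy⟩)
    (fun x hx y hy => ⟨⟨_, G.mul_mem (hMG hx) (hNG hy)⟩, congrArg Subtype.val (upperSL_mul _ _ _ _)⟩)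
  have hpow (i : Fin 3) (g : G) : ((g : Matrix (Fin 3) (Fin 3) F) i i) ^
      (Nat.card G / p ^ (Nat.card G).factorization p) = 1 := by
    apply pow_ordCompl_eq_one
    rw [← diagHom_apply G hblock, ← Pi.pow_apply, ← map_pow, pow_card_eq_one', map_one,
      Pi.one_apply]
  have hprod (g : G) : (g : Matrix (Fin 3) (Fin 3) F) 0 0 * (g : Matrix (Fin 3) (Fin 3) F) 1 1 *
      (g : Matrix (Fin 3) (Fin 3) F) 2 2 = 1 := by
    have h := (g : Matrix.SpecialLinearGroup (Fin 3) F).2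
    obtain ⟨g1, g2, g3, g4⟩ := hblock g g.2
    rw [Matrix.det_fin_three, g1, g2, g3, g4] at h
    simpa using h
  have hiff := isGorensteinRing_charMonoid_iff_of_mul_eq_one
    (fun g : G => (g : Matrix (Fin 3) (Fin 3) F) 0 0)
    (fun g : G => (g : Matrix (Fin 3) (Fin 3) F) 1 1)
    (fun g : G => (g : Matrix (Fin 3) (Fin 3) F) 2 2)
    (Nat.ordCompl_pos p Nat.card_pos.ne')
    ((Nat.coprime_ordCompl Fact.out Nat.card_pos.ne').pow_left n₁)
    (hpow 0) (hpow 1) (hpow 2) hprod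
  rw [Subtype.forall] at hiff
  exact Iff.trans ⟨IsGorensteinRing.of_ringEquiv e.symm, IsGorensteinRing.of_ringEquiv e⟩ hiff

end
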